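/- arXiv:1206.3392 — 5 statements merged into one kernel-verified Lean document; each statement's English description precedes it below -/
import Mathlib

section
/- Let T > 0 and let ψ be the characteristic function of a real-valued random variable such that ψ(t) = 0 whenever |t| ≥ π/T, and let f be the corresponding (continuous) probability density function. Then, for any s ∈ ℝ, the function Ψ: ℝ → ℂ defined by Ψ(ζ) = Σ_{n∈ℤ} ψ(ζ + 2nπ/T) e^{-i s (2nπ/T)} is the characteristic function of a discrete random variable supported within the set {kT + s : k ∈ ℤ}, with probability mass at the point kT + s equal to T·f(kT + s). -/
open MeasureTheory Real

open FourierTransform Filter Topology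

lemma aux_psi_cont (f : ℝ → ℝ) (ψ : ℝ → ℂ) (hi : Integrable f)
    (hψ : ∀ t : ℝ, ψ t = ∫ x : ℝ, (f x : ℂ) * Complex.exp (Complex.I * t * x)) :
    Continuous ψ := by
  have : ψ = fun t : ℝ => ∫ x : ℝ, (f x : ℂ) * Complex.exp (Complex.I * t * x) := funext hψ
  rw [this]
  refine continuous_of_dominated (bound := fun x => ‖f x‖) ?_ ?_ hi.norm ?_
  · intro t
    exact (hi.ofReal (𝕜 := ℂ)).aestronglyMeasurable.mul
      (Continuous.aestronglyMeasurable (by fun_prop))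
  · intro t
    refine Eventually.of_forall fun x => le_of_eq ?_
    have : Complex.I * t * x = ((t * x : ℝ) : ℂ) * Complex.I := by push_cast; ring
    rw [norm_mul, this, Complex.norm_exp_ofReal_mul_I, mul_one, Complex.norm_real]
  · exact Eventually.of_forall fun x => by fun_prop

lemma aux_zero_cocompact (T : ℝ) (hT : 0 < T) (ψ : ℝ → ℂ)
    (hsupp : ∀ t : ℝ, π / T ≤ |t| → ψ t = 0) (c : ℝ) (hc : c ≠ 0) :
    ∀ᶠ v in cocompact ℝ, ψ (c * v) = 0 := by
  have h := (tendsto_norm_cocompact_atTop (E := ℝ)).eventually_ge_atTop (π / T / |c|)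
  filter_upwards [h] with v hv
  apply hsupp
  rw [abs_mul]
  rw [div_le_iff₀ (abs_pos.2 hc), Real.norm_eq_abs] at hv
  linarith

/-- Fourier inversion. -/
lemma aux_inv (T : ℝ) (hT : 0 < T) (f : ℝ → ℝ) (ψ : ℝ → ℂ)
    (hf_cont : Continuous f) (hi : Integrable f)
    (hψ : ∀ t : ℝ, ψ t = ∫ x : ℝ, (f x : ℂ) * Complex.exp (Complex.I * t * x))
    (hsupp : ∀ t : ℝ, π / T ≤ |t| → ψ t = 0) (x : ℝ) :
    ∫ v : ℝ, Complex.exp (((-2 * π * v * x : ℝ) : ℂ) * Complex.I) * ψ (2 * π * v) = f x := by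
  have hc := aux_psi_cont f ψ hi hψ
  have h1 : 𝓕 (fun x => (f x : ℂ)) = fun v => ψ (-(2 * π) * v) := by
    ext v
    rw [fourier_real_eq_integral_exp_smul, hψ]
    congr 1 with y
    rw [smul_eq_mul, mul_comm]
    congr 2
    push_cast; ring
  have h2 : 𝓕⁻ (fun x => (f x : ℂ)) = fun v => ψ (2 * π * v) := by
    ext v
    rw [fourierInv_eq_fourier_neg, h1]
    simp
  have h3 : Integrable (𝓕 (fun x => (f x : ℂ))) := by
    rw [h1]
    apply Continuous.integrable_of_hasCompactSupport (by fun_prop)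
    rw [hasCompactSupport_iff_eventuallyEq]
    have := aux_zero_cocompact T hT ψ hsupp (-(2 * π)) (by simp [pi_ne_zero])
    rw [Filter.coclosedCompact_eq_cocompact]
    exact this
  have h4 := congrFun (Continuous.fourier_fourierInv_eq
    (by fun_prop : Continuous (fun x => (f x : ℂ))) hi.ofReal h3) x
  rw [h2, fourier_real_eq_integral_exp_smul] at h4
  simpa using h4

/-- Poisson summation under summability. -/
lemma aux_poisson (T : ℝ) (hT : 0 < T) (f : ℝ → ℝ) (ψ : ℝ → ℂ)
    (hf_cont : Continuous f) (hi : Integrable f)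
    (hψ : ∀ t : ℝ, ψ t = ∫ x : ℝ, (f x : ℂ) * Complex.exp (Complex.I * t * x))
    (hsupp : ∀ t : ℝ, π / T ≤ |t| → ψ t = 0) (s : ℝ)
    (hs : Summable (fun k : ℤ => T * f (k * T + s))) (ζ : ℝ) :
    ∑' n : ℤ, ψ (ζ + 2 * n * π / T) * Complex.exp (-(Complex.I * s * (2 * n * π / T)))
        = ∑' k : ℤ, ((T * f (k * T + s) : ℝ) : ℂ) *
            Complex.exp (Complex.I * ((k * T + s : ℝ) : ℂ) * ζ) := by
  have hc := aux_psi_cont f ψ hi hψ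
  have hTc : (T : ℂ) ≠ 0 := by exact_mod_cast hT.ne'
  have hpc : (π : ℂ) ≠ 0 := by exact_mod_cast pi_ne_zero
  set g : ℝ → ℂ := fun u => ψ (2 * π / T * u) * Complex.exp (-(Complex.I * s * (2 * π / T * u)))
    with hg
  have hgc : Continuous g := by fun_prop
  have hF : ∀ n : ℤ, 𝓕 g n = ((T * f (n * T + s) : ℝ) : ℂ) := by
    intro n
    rw [fourier_real_eq_integral_exp_smul]
    have := aux_inv T hT f ψ hf_cont hi hψ hsupp (n * T + s)
    rw [Complex.ofReal_mul, ← this]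
    have h5 := Measure.integral_comp_div (fun v : ℝ =>
      Complex.exp (((-2 * π * v * (n * T + s) : ℝ) : ℂ) * Complex.I) * ψ (2 * π * v)) T
    rw [abs_of_pos hT, Complex.real_smul] at h5
    rw [← h5]
    congr 1 with v
    rw [hg, smul_eq_mul]
    simp only
    rw [mul_left_comm, ← Complex.exp_add, mul_comm]
    congr 2
    · push_cast
      field_simp
      ring
    · ring
  have hO : g =O[cocompact ℝ] fun x : ℝ => |x| ^ (-(2:ℝ)) := by
    have hz := aux_zero_cocompact T hT ψ hsupp (2 * π / T) (by positivity)
    have : g =ᶠ[cocompact ℝ] fun _ => 0 := by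
      filter_upwards [hz] with v hv
      simp [hg, hv]
    exact this.trans_isBigO (Asymptotics.isBigO_zero _ _)
  have key := Real.tsum_eq_tsum_fourier_of_rpow_decay_of_summable hgc one_lt_two hO
    (by simp_rw [hF]; exact_mod_cast hs) (ζ * T / (2 * π))
  have e : ∀ n : ℤ, ψ (ζ + 2 * n * π / T) * Complex.exp (-(Complex.I * s * (2 * n * π / T)))
      = Complex.exp (Complex.I * s * ζ) * g (ζ * T / (2 * π) + n) := by
    intro n
    rw [hg]
    simp only
    rw [mul_left_comm, ← Complex.exp_add]
    congr 2
    · field_simp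
    · push_cast
      field_simp
      ring
  simp_rw [e]
  rw [tsum_mul_left, key, ← tsum_mul_left]
  congr 1 with n
  rw [hF, fourier_coe_apply, mul_left_comm, ← Complex.exp_add]
  congr 2
  push_cast
  field_simp
  ring

lemma aux_sum_one (T : ℝ) (hT : 0 < T) (f : ℝ → ℝ) (ψ : ℝ → ℂ)
    (hf_cont : Continuous f) (hi : Integrable f) (hf_int : ∫ x : ℝ, f x = 1)
    (hψ : ∀ t : ℝ, ψ t = ∫ x : ℝ, (f x : ℂ) * Complex.exp (Complex.I * t * x))
    (hsupp : ∀ t : ℝ, π / T ≤ |t| → ψ t = 0) (s : ℝ)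
    (hs : Summable (fun k : ℤ => T * f (k * T + s))) :
    ∑' k : ℤ, T * f (k * T + s) = 1 := by
  have h := aux_poisson T hT f ψ hf_cont hi hψ hsupp s hs 0
  rw [tsum_eq_single 0] at h
  · have h0 : ψ 0 = 1 := by
      rw [hψ]
      simp [integral_complex_ofReal, hf_int]
    simp only [Complex.ofReal_zero, mul_zero, Complex.exp_zero, mul_one] at h
    rw [← Complex.ofReal_tsum] at h
    simp [h0] at h
    exact_mod_cast h.symm
  · intro n hn
    rw [hsupp, zero_mul]
    rw [zero_add, abs_div, abs_mul, abs_mul, abs_of_pos hT, abs_of_pos pi_pos]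
    have : (1:ℝ) ≤ |(n:ℝ)| := by exact_mod_cast Int.one_le_abs hn
    gcongr
    rw [abs_of_pos (by norm_num : (0:ℝ) < 2)]
    nlinarith [pi_pos]

lemma aux_ae (T : ℝ) (hT : 0 < T) (f : ℝ → ℝ)
    (hf_cont : Continuous f) (hf_nn : ∀ x, 0 ≤ f x) (hi : Integrable f) (s : ℝ) :
    ∀ᵐ x ∂(volume.restrict (Set.Ioc s (s + T))), Summable (fun k : ℤ => T * f (k * T + x)) := by
  have h1 := (isAddFundamentalDomain_Ioc hT s).lintegral_eq_tsum'' (fun x => ENNReal.ofReal (f x))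
  have h2 : ∫⁻ x, ENNReal.ofReal (f x) ≠ ⊤ := hi.lintegral_lt_top.ne
  rw [h1, ← lintegral_tsum (fun i => by
    apply Measurable.aemeasurable
    apply ENNReal.measurable_ofReal.comp
    apply hf_cont.measurable.comp
    exact measurable_const_vadd _)] at h2
  have h3 := ae_lt_top' (by
    apply AEMeasurable.tsum
    intro i
    apply Measurable.aemeasurable
    apply ENNReal.measurable_ofReal.comp
    apply hf_cont.measurable.comp
    exact measurable_const_vadd _) h2
  filter_upwards [h3] with x hx
  apply Summable.mul_left
  have h4 := ENNReal.summable_toReal hx.ne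
  simp only [ENNReal.toReal_ofReal (hf_nn _)] at h4
  have hinj : Function.Injective (fun k : ℤ =>
      (⟨k • T, k, rfl⟩ : AddSubgroup.zmultiples T)) := by
    intro a b hab
    have : a • T = b • T := congrArg Subtype.val hab
    simpa [hT.ne'] using this
  have h5 := h4.comp_injective hinj
  refine h5.congr fun k => ?_
  simp [AddSubgroup.vadd_def]

lemma aux_summable (T : ℝ) (hT : 0 < T) (f : ℝ → ℝ) (ψ : ℝ → ℂ)
    (hf_cont : Continuous f) (hf_nn : ∀ x, 0 ≤ f x) (hi : Integrable f)
    (hf_int : ∫ x : ℝ, f x = 1)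
    (hψ : ∀ t : ℝ, ψ t = ∫ x : ℝ, (f x : ℂ) * Complex.exp (Complex.I * t * x))
    (hsupp : ∀ t : ℝ, π / T ≤ |t| → ψ t = 0) (s : ℝ) :
    Summable (fun k : ℤ => T * f (k * T + s)) := by
  have hnn : ∀ x, ∀ k : ℤ, 0 ≤ T * f (k * T + x) := fun x k => mul_nonneg hT.le (hf_nn _)
  apply summable_of_sum_le (c := 1) (hnn s)
  intro u
  by_contra! hlt
  have hcont : Continuous (fun x => ∑ k ∈ u, T * f (k * T + x)) := by fun_prop
  have hev := hcont.continuousAt.eventually (lt_mem_nhds hlt)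
  obtain ⟨δ, hδ, hball⟩ := Metric.eventually_nhds_iff.1 hev
  have hae := aux_ae T hT f hf_cont hf_nn hi s
  rw [ae_restrict_iff' measurableSet_Ioc] at hae
  have hnull : ∀ᵐ x, x ∉ Set.Ioo s (s + min δ T) := by
    filter_upwards [hae] with x hx hxm
    have hm := min_le_left δ T
    have hm' := min_le_right δ T
    have hsx := hx ⟨hxm.1, by linarith [hxm.2]⟩
    have h1 := aux_sum_one T hT f ψ hf_cont hi hf_int hψ hsupp x hsx
    have h2 := hsx.sum_le_tsum u (fun k _ => hnn x k)
    have h3 := hball (y := x) (by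
      rw [Real.dist_eq, abs_of_pos (by linarith [hxm.1])]; linarith [hxm.2])
    linarith
  have hv : volume (Set.Ioo s (s + min δ T)) = 0 := by
    exact measure_eq_zero_iff_ae_notMem.2 hnull
  rw [Real.volume_Ioo, ENNReal.ofReal_eq_zero] at hv
  have := lt_min hδ hT
  linarith

/-- **Poisson summation for band-limited characteristic functions.**
Let `T > 0` and let `ψ` be the characteristic function of a real-valued random variable with
(continuous) density `f`, such that `ψ(t) = 0` whenever `|t| ≥ π/T`.  Then for any `s ∈ ℝ`,
the function `Ψ(ζ) = Σ_{n ∈ ℤ} ψ(ζ + 2nπ/T) e^{-is(2nπ/T)}` is the characteristic function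
of a discrete random variable supported within `{kT + s : k ∈ ℤ}`, the probability mass at
the point `kT + s` being `T · f(kT + s)`. -/
theorem poisson_summation_charfun
    (T : ℝ) (hT : 0 < T) (f : ℝ → ℝ) (ψ : ℝ → ℂ)
    (hf_cont : Continuous f) (hf_nn : ∀ x, 0 ≤ f x) (hf_int : ∫ x : ℝ, f x = 1)
    (hψ : ∀ t : ℝ, ψ t = ∫ x : ℝ, (f x : ℂ) * Complex.exp (Complex.I * t * x))
    (hsupp : ∀ t : ℝ, π / T ≤ |t| → ψ t = 0) (s : ℝ) :
    -- `(T f(kT+s))_{k ∈ ℤ}` is a pmf on `{kT + s : k ∈ ℤ}` ...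
    (∀ k : ℤ, 0 ≤ T * f (k * T + s)) ∧
    HasSum (fun k : ℤ => T * f (k * T + s)) 1 ∧
    -- ... whose characteristic function is `Ψ`
    (∀ ζ : ℝ, ∑' n : ℤ, ψ (ζ + 2 * n * π / T) * Complex.exp (-(Complex.I * s * (2 * n * π / T)))
        = ∑' k : ℤ, ((T * f (k * T + s) : ℝ) : ℂ) *
            Complex.exp (Complex.I * ((k * T + s : ℝ) : ℂ) * ζ)) := by
  have hi : Integrable f := by
    by_contra h
    rw [integral_undef h] at hf_int
    exact zero_ne_one hf_int
  have hs := aux_summable T hT f ψ hf_cont hf_nn hi hf_int hψ hsupp s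
  refine ⟨fun k => mul_nonneg hT.le (hf_nn _), ?_, ?_⟩
  · rw [← aux_sum_one T hT f ψ hf_cont hi hf_int hψ hsupp s hs]
    exact hs.hasSum
  · exact aux_poisson T hT f ψ hf_cont hi hψ hsupp s hs
end

section
/- Let ψ be the characteristic function of a real-valued random variable such that ψ(t) = 0 whenever |t| ≥ π/T for some T > 0, and let f be the corresponding continuous probability density function. Then for every s ∈ ℝ, Σ_{k∈ℤ} f(kT + s) = 1/T. -/
open MeasureTheory Real

open Filter Topology FourierTransform in
lemma sinc_repr (r : ℝ) : ∫ u in (-1:ℝ)..1, Complex.exp ((r * u : ℝ) * Complex.I) = 2 * (sinc r : ℂ) := by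
  by_cases hr : r = 0
  · subst hr; simp; norm_num
  have h := intervalIntegral.smul_integral_comp_mul_left (a := -1) (b := 1)
    (fun t : ℝ => Complex.exp (t * Complex.I)) r
  have h2 : r * (-1) = -r := by ring
  rw [h2, mul_one, integral_exp_mul_I_eq_sinc] at h
  have hr' : (r : ℂ) ≠ 0 := by exact_mod_cast hr
  apply mul_left_cancel₀ hr'
  rw [Complex.real_smul] at h
  rw [h]; ring

open Filter Topology FourierTransform in
lemma damp (G : ℝ → ℂ) (hG : Integrable G) (c ε : ℝ) (hε : 0 ≤ ε)
    (h0 : ∀ w : ℝ, c ≤ |w| → 𝓕 G w = 0) (w : ℝ) (hw : c + ε ≤ |w|) :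
    𝓕 (fun x => G x * (sinc (2 * π * ε * x) : ℂ)) w = 0 := by
  have key : ∫ u in (-1:ℝ)..1, 𝓕 G (w - ε * u)
      = 2 * 𝓕 (fun x => G x * (sinc (2 * π * ε * x) : ℂ)) w := by
    simp only [fourier_real_eq_integral_exp_smul]
    rw [intervalIntegral_integral_swap, ← integral_const_mul]
    · congr 1
      ext x
      have h := sinc_repr (2 * π * ε * x)
      calc _ = ∫ u in (-1:ℝ)..1, (Complex.exp (↑(-2 * π * x * w) * Complex.I) * G x) *
            Complex.exp ((2 * π * ε * x * u : ℝ) * Complex.I) := by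
            congr 1; ext u
            rw [smul_eq_mul, mul_right_comm (Complex.exp (↑(-2 * π * x * w) * Complex.I)),
              ← Complex.exp_add]
            congr 2; push_cast; ring
        _ = _ := by
            rw [intervalIntegral.integral_const_mul, h, smul_eq_mul]; ring
    · have : IsFiniteMeasure (volume.restrict (Set.uIoc (-1:ℝ) 1)) :=
        ⟨by simp [Set.uIoc]⟩
      have h1 : Integrable (fun p : ℝ × ℝ => G p.2)
          ((volume.restrict (Set.uIoc (-1:ℝ) 1)).prod volume) := hG.comp_snd _
      refine (h1.bdd_mul (c := 1)
        (f := fun p : ℝ × ℝ => Complex.exp (↑(-2 * π * p.2 * (w - ε * p.1)) * Complex.I)) ?_ ?_)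
      · exact Continuous.aestronglyMeasurable (by fun_prop)
      · refine Eventually.of_forall fun p => ?_
        rw [Complex.norm_exp_ofReal_mul_I]
  have hz : ∫ u in (-1:ℝ)..1, 𝓕 G (w - ε * u) = 0 := by
    rw [intervalIntegral.integral_congr (g := fun _ => 0)]
    · simp
    · intro u hu
      rw [Set.uIcc_of_le (by norm_num)] at hu
      apply h0
      have h1 : |w| ≤ |w - ε * u| + |ε * u| := by
        have := abs_add_le (w - ε * u) (ε * u); simpa using this
      have h2 : |ε * u| ≤ ε := by
        rw [abs_mul, abs_of_nonneg hε]
        exact mul_le_of_le_one_right hε (abs_le.2 hu)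
      linarith
  rw [hz] at key
  simpa using key.symm

open Filter Topology FourierTransform in
lemma poisson_unit (F : ℝ → ℝ) (hc : Continuous F) (hnn : ∀ x, 0 ≤ F x) (hi : ∫ x, F x = 1)
    (h0 : ∀ w : ℝ, 1/2 ≤ |w| → 𝓕 (fun x => (F x : ℂ)) w = 0) (x : ℝ) :
    ∑' n : ℤ, F (x + n) = 1 := by
  have hI : Integrable F := by
    by_contra h; rw [integral_undef h] at hi; norm_num at hi
  have hIc : Integrable (fun x => (F x : ℂ)) := hI.ofReal
  -- boundedness
  obtain ⟨C, hC⟩ : ∃ C, ∀ x, F x ≤ C := by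
    have hcF : Continuous (𝓕 (fun x => (F x : ℂ))) :=
      VectorFourier.fourierIntegral_continuous Real.continuous_fourierChar
        (by exact continuous_inner) hIc
    have hFI : Integrable (𝓕 (fun x => (F x : ℂ))) := by
      apply hcF.integrable_of_hasCompactSupport
      apply HasCompactSupport.intro (isCompact_Icc (a := (-1/2:ℝ)) (b := 1/2))
      intro w hw
      apply h0
      by_contra! h
      exact hw ⟨by linarith [(abs_lt.1 h).1], by linarith [(abs_lt.1 h).2]⟩
    have hinv := Continuous.fourierInv_fourier_eq (Complex.continuous_ofReal.comp hc) hIc hFI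
    refine ⟨∫ w, ‖𝓕 (fun x => (F x : ℂ)) w‖, fun y => ?_⟩
    have h1 : 𝓕⁻ (𝓕 (fun x => (F x : ℂ))) y = (F y : ℂ) := congrFun hinv y
    have h2 : ‖((F y : ℝ) : ℂ)‖ = F y := by simp [abs_of_nonneg (hnn y)]
    rw [← h2, ← h1]
    exact VectorFourier.norm_fourierIntegral_le_integral_norm _ _ _ _ _
  let g : ℝ → ℝ → ℝ := fun ε x => F x * sinc (2 * π * ε * x) ^ 2
  have hs : ∀ y, sinc y ^ 2 ≤ 1 := fun y => by
    rw [sq_le_one_iff_abs_le_one]; exact abs_sinc_le_one y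
  have hgn : ∀ ε x, 0 ≤ g ε x := fun ε x => mul_nonneg (hnn x) (sq_nonneg _)
  have hgF : ∀ ε x, g ε x ≤ F x := fun ε x => mul_le_of_le_one_right (hnn x) (hs _)
  have hgc : ∀ ε, Continuous (g ε) := fun ε => by
    have := continuous_sinc
    fun_prop
  have hgt : ∀ y, Tendsto (fun ε => g ε y) (𝓝[>] 0) (𝓝 (F y)) := fun y => by
    have : Continuous (fun ε => g ε y) := by
      have := continuous_sinc
      fun_prop
    have h := this.tendsto 0
    simp only [g, mul_zero, zero_mul, sinc_zero, one_pow, mul_one] at h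
    exact h.mono_left nhdsWithin_le_nhds
  have hint : Tendsto (fun ε => ∫ y, g ε y) (𝓝[>] 0) (𝓝 1) := by
    rw [← hi]
    refine tendsto_integral_filter_of_dominated_convergence F ?_ ?_ hI ?_
    · exact Eventually.of_forall fun ε => (hgc ε).aestronglyMeasurable
    · refine Eventually.of_forall fun ε => Eventually.of_forall fun y => ?_
      rw [Real.norm_of_nonneg (hgn _ _)]; exact hgF _ _
    · exact Eventually.of_forall hgt
  have hpo : ∀ ε, 0 < ε → ε ≤ 1/4 → ∑' n : ℤ, g ε (x + n) = ∫ y, g ε y := by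
    intro ε he he4
    have hd1 := damp _ hIc (1/2) ε he.le h0
    have hI1 : Integrable (fun x => (F x : ℂ) * (sinc (2 * π * ε * x) : ℂ)) := by
      refine hIc.mul_bdd (c := 1) ?_ ?_
      · have := continuous_sinc
        exact Continuous.aestronglyMeasurable (by fun_prop)
      · refine Eventually.of_forall fun y => ?_
        simpa using abs_sinc_le_one _
    have hd2 := damp _ hI1 (1/2 + ε) ε he.le hd1
    have hge : (fun x => (F x : ℂ) * (sinc (2 * π * ε * x) : ℂ) * (sinc (2 * π * ε * x) : ℂ))
        = fun x => (g ε x : ℂ) := by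
      ext y; simp only [g]; push_cast; ring
    rw [hge] at hd2
    have hn : ∀ n : ℤ, n ≠ 0 → 𝓕 (fun x => (g ε x : ℂ)) n = 0 := by
      intro n hn
      apply hd2
      have : (1:ℝ) ≤ |(n:ℝ)| := by exact_mod_cast Int.one_le_abs hn
      linarith
    have hP := Real.tsum_eq_tsum_fourier_of_rpow_decay_of_summable (f := fun x => (g ε x : ℂ))
      (Complex.continuous_ofReal.comp (hgc ε)) (b := 2) one_lt_two ?_ ?_ x
    · rw [tsum_eq_single (f := fun n : ℤ => 𝓕 (fun x => (g ε x : ℂ)) n * _ ) 0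
        (fun n hnn => by rw [hn n hnn, zero_mul])] at hP
      simp only [fourier_real_eq_integral_exp_smul] at hP
      simp [integral_complex_ofReal] at hP
      exact_mod_cast hP
    · refine Asymptotics.IsBigO.of_bound (C / (2 * π * ε) ^ 2) ?_
      have hne : ∀ᶠ y in cocompact ℝ, y ≠ 0 := by
        have := (isCompact_singleton (x := (0:ℝ))).compl_mem_cocompact
        filter_upwards [this] with y hy using hy
      filter_upwards [hne] with y hy
      have hpe : 0 < 2 * π * ε := by positivity
      rw [Complex.norm_real, Real.norm_of_nonneg (hgn _ _), Real.norm_of_nonneg (by positivity),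
        Real.rpow_neg (abs_nonneg y), Real.rpow_two, sq_abs]
      simp only [g]
      rw [sinc_of_ne_zero (by positivity), div_pow, mul_pow (2 * π * ε) y]
      have hsin := Real.sin_sq_le_one (2 * π * ε * y)
      have hy2 : 0 < y ^ 2 := by positivity
      calc _ ≤ C * (1 / ((2 * π * ε) ^ 2 * y ^ 2)) := by
            have := hC y
            have := (hnn y).trans this
            gcongr
        _ = _ := by field_simp
    · apply summable_of_ne_finset_zero (s := {0})
      intro n hnn
      exact hn n (by simpa using hnn)
  have hev : ∀ᶠ ε in 𝓝[>] (0:ℝ), ∑' n : ℤ, g ε (x + n) = ∫ y, g ε y := by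
    have : Set.Ioc (0:ℝ) (1/4) ∈ 𝓝[>] (0:ℝ) := Ioc_mem_nhdsGT (by norm_num)
    filter_upwards [this] with ε h using hpo ε h.1 h.2
  have hlim : Tendsto (fun ε => ∑' n : ℤ, g ε (x + n)) (𝓝[>] 0) (𝓝 1) :=
    hint.congr' (hev.mono fun _ h => h.symm)
  have hsum : Summable (fun n : ℤ => F (x + n)) := by
    refine summable_of_sum_le (c := 1) (fun n => hnn _) fun S => ?_
    refine le_of_tendsto_of_tendsto (tendsto_finsetSum S fun n _ => hgt (x + n)) hlim ?_
    filter_upwards [hlim.eventually_ne one_ne_zero] with ε h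
    have : Summable (fun n : ℤ => g ε (x + n)) := by
      by_contra h'; exact h (tsum_eq_zero_of_not_summable h')
    exact this.sum_le_tsum S fun n _ => hgn _ _
  have hlim2 : Tendsto (fun ε => ∑' n : ℤ, g ε (x + n)) (𝓝[>] 0) (𝓝 (∑' n : ℤ, F (x + n))) := by
    refine tendsto_tsum_of_dominated_convergence hsum (fun n => hgt _) ?_
    refine Eventually.of_forall fun ε n => ?_
    rw [Real.norm_of_nonneg (hgn _ _)]; exact hgF _ _
  exact tendsto_nhds_unique hlim2 hlim

/-- Let `ψ` be the characteristic function of a real-valued random variable,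
with `ψ(t) = 0` whenever `|t| ≥ π/T` for some `T > 0`, and let `f` be the corresponding
continuous probability density.  Then for every `s ∈ ℝ`, `Σ_{k ∈ ℤ} f(kT + s) = 1/T`. -/
theorem sum_density_on_translated_lattice
    (T : ℝ) (hT : 0 < T) (f : ℝ → ℝ) (ψ : ℝ → ℂ)
    (hf_cont : Continuous f) (hf_nn : ∀ x, 0 ≤ f x) (hf_int : ∫ x : ℝ, f x = 1)
    (hψ : ∀ t : ℝ, ψ t = ∫ x : ℝ, (f x : ℂ) * Complex.exp (Complex.I * t * x))
    (hsupp : ∀ t : ℝ, π / T ≤ |t| → ψ t = 0) :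
    ∀ s : ℝ, ∑' k : ℤ, f (k * T + s) = 1 / T := by
  intro s
  have hT' : T ≠ 0 := hT.ne'
  have h := poisson_unit (fun x => T * f (T * x)) (by fun_prop)
    (fun x => mul_nonneg hT.le (hf_nn _)) ?_ ?_ (s / T)
  · have h2 : ∀ n : ℤ, T * f (T * (s / T + n)) = T * f (n * T + s) := by
      intro n
      congr 2; field_simp; ring
    simp only [h2] at h
    rw [tsum_mul_left] at h
    field_simp
    linarith
  · rw [integral_const_mul, Measure.integral_comp_mul_left f T, hf_int]
    simp [abs_of_pos hT, hT']
  · intro w hw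
    rw [Real.fourier_real_eq_integral_exp_smul]
    have hz := hsupp (-(2 * π * w / T)) (by
      rw [abs_neg, abs_div, abs_mul, abs_of_pos hT, abs_of_pos (by positivity : 0 < 2 * π)]
      gcongr
      nlinarith [pi_pos])
    rw [hψ] at hz
    have hsc := Measure.integral_comp_mul_left (fun y : ℝ => (f y : ℂ) *
      Complex.exp (Complex.I * (-(2 * π * w / T) : ℝ) * y)) T
    rw [hz, smul_zero] at hsc
    calc _ = ∫ x : ℝ, (T : ℂ) * ((f (T * x) : ℂ) *
          Complex.exp (Complex.I * (-(2 * π * w / T) : ℝ) * (T * x : ℝ))) := by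
          congr 1; ext x
          have : (↑(-2 * π * x * w) * Complex.I : ℂ)
              = Complex.I * (-(2 * π * w / T) : ℝ) * (T * x : ℝ) := by
            have : (T : ℂ) ≠ 0 := by exact_mod_cast hT'
            push_cast; field_simp
          rw [this, smul_eq_mul]; push_cast; ring
      _ = 0 := by rw [integral_const_mul, hsc, mul_zero]
end

section
/- Let f: ℝ → ℝ be defined by f(0) = 1/(2π) and f(x) = (1 − cos x)/(π x²) for x ≠ 0, and let g(t) = (1/2)|t|³ − t² + 2/3 for |t| ≤ 1, g(t) = (1/6)(2 − |t|)³ for 1 ≤ |t| ≤ 2, and g(t) = 0 otherwise. Then the function h(x) = (3π²/4)·[f(πx/4)]² is a probability density function whose characteristic function is ψ(t) = (3/2)·g(4t/π). Furthermore, ψ is non-negative with ψ(t) = 0 for |t| ≥ π/2, ψ is twice differentiable, and ψ''(0) = −48/π². -/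
open Real MeasureTheory

/-- The explicit piecewise formula for `g = f̂ ∗ f̂`, where `f̂(t) = max{0, 1 − |t|}`. -/
noncomputable def triangleSelfConv (t : ℝ) : ℝ :=
  if |t| ≤ 1 then (1 / 2) * |t| ^ 3 - t ^ 2 + 2 / 3
  else if |t| ≤ 2 then (1 / 6) * (2 - |t|) ^ 3
  else 0


theorem pp3 (x : ℝ) : HasDerivAt (fun t : ℝ => (max t 0) ^ 3) (3 * (max x 0) ^ 2) x := by
  rcases lt_trichotomy x 0 with h | h | h
  · rw [max_eq_right h.le]
    have : HasDerivAt (fun _ : ℝ => (0 : ℝ)) 0 x := hasDerivAt_const x 0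
    refine (this.congr_of_eventuallyEq ?_).congr_deriv ?_
    rotate_left
    · norm_num
    · filter_upwards [Iio_mem_nhds h] with t ht
      rw [max_eq_right (le_of_lt ht)]; norm_num
  · subst h
    rw [hasDerivAt_iff_isLittleO]
    have h1 : (fun t : ℝ => t ^ 2) =o[nhds 0] fun t => t := by
      simpa using (Asymptotics.isLittleO_pow_id (𝕜 := ℝ) (n := 2) (by norm_num))
    refine Asymptotics.IsBigO.trans_isLittleO ?_ (by simpa using h1)
    refine Asymptotics.IsBigO.of_bound 1 ?_
    filter_upwards [Icc_mem_nhds (show (-1 : ℝ) < 0 by norm_num) (show (0 : ℝ) < 1 by norm_num)] with t ht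
    simp only [max_self, ne_eq, OfNat.ofNat_ne_zero, not_false_eq_true, zero_pow, mul_zero, sub_zero,
      smul_zero, norm_pow, Real.norm_eq_abs, one_mul, sq_abs]
    rcases le_total t 0 with h | h
    · rw [max_eq_right h]; simp; positivity
    · rw [max_eq_left h, abs_of_nonneg h]; nlinarith [ht.2, sq_nonneg t]
  · rw [max_eq_left h.le]
    have : HasDerivAt (fun t : ℝ => t ^ 3) (3 * x ^ 2) x := by simpa using hasDerivAt_pow 3 x
    refine this.congr_of_eventuallyEq ?_
    filter_upwards [Ioi_mem_nhds h] with t ht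
    rw [max_eq_left (le_of_lt ht)]

theorem pp2 (x : ℝ) : HasDerivAt (fun t : ℝ => (max t 0) ^ 2) (2 * (max x 0)) x := by
  rcases lt_trichotomy x 0 with h | h | h
  · rw [max_eq_right h.le]
    have : HasDerivAt (fun _ : ℝ => (0 : ℝ)) 0 x := hasDerivAt_const x 0
    refine (this.congr_of_eventuallyEq ?_).congr_deriv ?_
    rotate_left
    · norm_num
    · filter_upwards [Iio_mem_nhds h] with t ht
      rw [max_eq_right (le_of_lt ht)]; norm_num
  · subst h
    rw [hasDerivAt_iff_isLittleO]
    have h1 : (fun t : ℝ => t ^ 2) =o[nhds 0] fun t => t := by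
      simpa using (Asymptotics.isLittleO_pow_id (𝕜 := ℝ) (n := 2) (by norm_num))
    refine Asymptotics.IsBigO.trans_isLittleO ?_ (by simpa using h1)
    refine Asymptotics.IsBigO.of_bound 1 (Filter.Eventually.of_forall fun t => ?_)
    simp only [max_self, ne_eq, OfNat.ofNat_ne_zero, not_false_eq_true, zero_pow, mul_zero, sub_zero,
      smul_zero, norm_pow, Real.norm_eq_abs, one_mul, sq_abs]
    rcases le_total t 0 with h | h
    · rw [max_eq_right h]; simp; positivity
    · rw [max_eq_left h]
  · rw [max_eq_left h.le]
    have : HasDerivAt (fun t : ℝ => t ^ 2) (2 * x) x := by simpa using hasDerivAt_pow 2 x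
    refine this.congr_of_eventuallyEq ?_
    filter_upwards [Ioi_mem_nhds h] with t ht
    rw [max_eq_left (le_of_lt ht)]

theorem tsc_eq (t : ℝ) : triangleSelfConv t = (1 / 6) * (max (t + 2) 0 ^ 3 - 4 * max (t + 1) 0 ^ 3
    + 6 * max t 0 ^ 3 - 4 * max (t - 1) 0 ^ 3 + max (t - 2) 0 ^ 3) := by
  unfold triangleSelfConv
  have key : ∀ a : ℝ, (0 ≤ a ∧ max a 0 = a) ∨ (a ≤ 0 ∧ max a 0 = 0) := fun a => by
    rcases le_total a 0 with h | h
    · right; exact ⟨h, max_eq_right h⟩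
    · left; exact ⟨h, max_eq_left h⟩
  have E : ∀ a : ℝ, a = 0 → a ^ 3 = 0 := by rintro a rfl; norm_num
  rcases le_total t 0 with h0 | h0
  · rw [abs_of_nonpos h0, max_eq_right h0, max_eq_right (by linarith : t - 1 ≤ 0),
      max_eq_right (by linarith : t - 2 ≤ 0)]
    split_ifs with h1 h2
    · rw [max_eq_left (by linarith), max_eq_left (by linarith)]; ring
    · rw [max_eq_left (by linarith), max_eq_right (by linarith)]; ring
    · rw [max_eq_right (by linarith), max_eq_right (by linarith)]; ring
  · rw [abs_of_nonneg h0, max_eq_left h0, max_eq_left (by linarith : 0 ≤ t + 1),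
      max_eq_left (by linarith : 0 ≤ t + 2)]
    split_ifs with h1 h2
    · rw [max_eq_right (by linarith), max_eq_right (by linarith)]; ring
    · rw [max_eq_left (by linarith), max_eq_right (by linarith)]; ring
    · rw [max_eq_left (by linarith), max_eq_left (by linarith)]; ring

theorem tsc_cont : Continuous triangleSelfConv := by
  rw [funext tsc_eq]; fun_prop

noncomputable def tscD (t : ℝ) : ℝ := (1 / 2) * (max (t + 2) 0 ^ 2 - 4 * max (t + 1) 0 ^ 2
    + 6 * max t 0 ^ 2 - 4 * max (t - 1) 0 ^ 2 + max (t - 2) 0 ^ 2)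

noncomputable def tscDD (t : ℝ) : ℝ := (max (t + 2) 0 - 4 * max (t + 1) 0
    + 6 * max t 0 - 4 * max (t - 1) 0 + max (t - 2) 0)

theorem tsc_deriv (t : ℝ) : HasDerivAt triangleSelfConv (tscD t) t := by
  rw [funext tsc_eq]
  have H := (((((pp3 (t + 2)).comp_add_const t 2).sub
    (((pp3 (t + 1)).comp_add_const t 1).const_mul 4)).add ((pp3 t).const_mul 6)).sub
    (((pp3 (t - 1)).comp_sub_const t 1).const_mul 4)).add ((pp3 (t - 2)).comp_sub_const t 2)
  refine (H.const_mul (1 / 6)).congr_deriv ?_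
  unfold tscD; ring

theorem tscD_deriv (t : ℝ) : HasDerivAt tscD (tscDD t) t := by
  have H := (((((pp2 (t + 2)).comp_add_const t 2).sub
    (((pp2 (t + 1)).comp_add_const t 1).const_mul 4)).add ((pp2 t).const_mul 6)).sub
    (((pp2 (t - 1)).comp_sub_const t 1).const_mul 4)).add ((pp2 (t - 2)).comp_sub_const t 2)
  refine (H.const_mul (1 / 2)).congr_deriv ?_
  unfold tscDD; ring

theorem tsc_nonneg (t : ℝ) : 0 ≤ triangleSelfConv t := by
  unfold triangleSelfConv
  split_ifs with h1 h2
  · rw [← sq_abs]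
    nlinarith [abs_nonneg t, mul_nonneg (abs_nonneg t) (sq_nonneg (|t|)), sq_nonneg (|t| - 1),
      mul_nonneg (sub_nonneg.2 h1) (abs_nonneg t), mul_nonneg (sub_nonneg.2 h1) (sq_nonneg |t|)]
  · have : 0 ≤ 2 - |t| := by linarith
    positivity
  · exact le_rfl

theorem tsc_zero (t : ℝ) (ht : 2 ≤ |t|) : triangleSelfConv t = 0 := by
  unfold triangleSelfConv
  split_ifs with h1 h2
  · linarith
  · have : |t| = 2 := le_antisymm h2 ht
    rw [this]; norm_num
  · rfl

theorem cub_int (w : ℂ) (hw : w ≠ 0) (c0 c1 c2 c3 : ℂ) (a b : ℝ) :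
    ∫ t in a..b, Complex.exp (w * t) * (c0 + c1 * t + c2 * t ^ 2 + c3 * t ^ 3) =
    Complex.exp (w * b) * ((c0 + c1 * b + c2 * b ^ 2 + c3 * b ^ 3) / w
      - (c1 + 2 * c2 * b + 3 * c3 * b ^ 2) / w ^ 2 + (2 * c2 + 6 * c3 * b) / w ^ 3 - 6 * c3 / w ^ 4)
    - Complex.exp (w * a) * ((c0 + c1 * a + c2 * a ^ 2 + c3 * a ^ 3) / w
      - (c1 + 2 * c2 * a + 3 * c3 * a ^ 2) / w ^ 2 + (2 * c2 + 6 * c3 * a) / w ^ 3 - 6 * c3 / w ^ 4) := by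
  refine intervalIntegral.integral_eq_sub_of_hasDerivAt (f := fun t : ℝ => Complex.exp (w * t) * ((c0 + c1 * t + c2 * t ^ 2 + c3 * t ^ 3) / w
      - (c1 + 2 * c2 * t + 3 * c3 * t ^ 2) / w ^ 2 + (2 * c2 + 6 * c3 * t) / w ^ 3 - 6 * c3 / w ^ 4)) ?_ ?_
  · intro x _
    have h1 : HasDerivAt (fun z : ℂ => z) 1 (x : ℂ) := hasDerivAt_id _
    have h2 : HasDerivAt (fun z : ℂ => z ^ 2) (2 * x) (x : ℂ) := by simpa using hasDerivAt_pow 2 (x : ℂ)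
    have h3 : HasDerivAt (fun z : ℂ => z ^ 3) (3 * x ^ 2) (x : ℂ) := by simpa using hasDerivAt_pow 3 (x : ℂ)
    have he := (h1.const_mul w).cexp
    have p0 := ((((h1.const_mul c1).const_add c0).add (h2.const_mul c2)).add (h3.const_mul c3)).div_const w
    have p1 := (((h1.const_mul (2 * c2)).const_add c1).add (h2.const_mul (3 * c3))).div_const (w ^ 2)
    have p2 := ((h1.const_mul (6 * c3)).const_add (2 * c2)).div_const (w ^ 3)
    have H := (he.mul (((p0.sub p1).add p2).sub_const (6 * c3 / w ^ 4))).comp_ofReal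
    refine H.congr_deriv ?_
    simp only [Pi.add_apply, Pi.sub_apply]
    field_simp
    ring
  · apply Continuous.intervalIntegrable
    fun_prop

theorem tsc_int (w : ℂ) (hw : w ≠ 0) :
    ∫ t : ℝ, Complex.exp (w * t) * (triangleSelfConv t : ℂ) =
      ((Complex.exp w + Complex.exp (-w) - 2) / w ^ 2) ^ 2 := by
  have hc : Continuous fun t : ℝ => Complex.exp (w * t) * (triangleSelfConv t : ℂ) := by
    have := tsc_cont
    fun_prop
  have h1 : ∫ t : ℝ, Complex.exp (w * t) * (triangleSelfConv t : ℂ) =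
      ∫ t in (-2 : ℝ)..2, Complex.exp (w * t) * (triangleSelfConv t : ℂ) := by
    rw [intervalIntegral.integral_of_le (by norm_num)]
    symm
    apply setIntegral_eq_integral_of_forall_compl_eq_zero
    intro t ht
    rw [tsc_zero t]
    · simp
    · by_contra hlt
      rw [not_le, abs_lt] at hlt
      exact ht ⟨hlt.1, hlt.2.le⟩
  rw [h1, ← intervalIntegral.integral_add_adjacent_intervals (b := -1) (hc.intervalIntegrable _ _) (hc.intervalIntegrable _ _),
    ← intervalIntegral.integral_add_adjacent_intervals (a := -1) (b := 0) (hc.intervalIntegrable _ _) (hc.intervalIntegrable _ _),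
    ← intervalIntegral.integral_add_adjacent_intervals (a := 0) (b := 1) (hc.intervalIntegrable _ _) (hc.intervalIntegrable _ _)]
  have e1 : ∫ t in (-2 : ℝ)..(-1), Complex.exp (w * t) * (triangleSelfConv t : ℂ) =
      ∫ t in (-2 : ℝ)..(-1), Complex.exp (w * t) * ((4 / 3 : ℂ) + 2 * t + 1 * t ^ 2 + (1 / 6) * t ^ 3) := by
    apply intervalIntegral.integral_congr
    intro t ht
    rw [Set.uIcc_of_le (by norm_num)] at ht
    obtain ⟨ha, hb⟩ := ht
    simp only
    rw [tsc_eq, max_eq_left (by linarith), max_eq_right (by linarith), max_eq_right (by linarith),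
      max_eq_right (by linarith), max_eq_right (by linarith)]
    push_cast; ring
  have e2 : ∫ t in (-1 : ℝ)..0, Complex.exp (w * t) * (triangleSelfConv t : ℂ) =
      ∫ t in (-1 : ℝ)..0, Complex.exp (w * t) * ((2 / 3 : ℂ) + 0 * t + (-1) * t ^ 2 + (-1 / 2) * t ^ 3) := by
    apply intervalIntegral.integral_congr
    intro t ht
    rw [Set.uIcc_of_le (by norm_num)] at ht
    obtain ⟨ha, hb⟩ := ht
    simp only
    rw [tsc_eq, max_eq_left (by linarith), max_eq_left (by linarith), max_eq_right (by linarith),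
      max_eq_right (by linarith), max_eq_right (by linarith)]
    push_cast; ring
  have e3 : ∫ t in (0 : ℝ)..1, Complex.exp (w * t) * (triangleSelfConv t : ℂ) =
      ∫ t in (0 : ℝ)..1, Complex.exp (w * t) * ((2 / 3 : ℂ) + 0 * t + (-1) * t ^ 2 + (1 / 2) * t ^ 3) := by
    apply intervalIntegral.integral_congr
    intro t ht
    rw [Set.uIcc_of_le (by norm_num)] at ht
    obtain ⟨ha, hb⟩ := ht
    simp only
    rw [tsc_eq, max_eq_left (by linarith), max_eq_left (by linarith), max_eq_left (by linarith),
      max_eq_right (by linarith), max_eq_right (by linarith)]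
    push_cast; ring
  have e4 : ∫ t in (1 : ℝ)..2, Complex.exp (w * t) * (triangleSelfConv t : ℂ) =
      ∫ t in (1 : ℝ)..2, Complex.exp (w * t) * ((4 / 3 : ℂ) + (-2) * t + 1 * t ^ 2 + (-1 / 6) * t ^ 3) := by
    apply intervalIntegral.integral_congr
    intro t ht
    rw [Set.uIcc_of_le (by norm_num)] at ht
    obtain ⟨ha, hb⟩ := ht
    simp only
    rw [tsc_eq, max_eq_left (by linarith), max_eq_left (by linarith), max_eq_left (by linarith),
      max_eq_left (by linarith), max_eq_right (by linarith)]
    push_cast; ring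
  rw [e1, e2, e3, e4, cub_int w hw, cub_int w hw, cub_int w hw, cub_int w hw]
  have x2 : Complex.exp (w * (2 : ℝ)) = Complex.exp w ^ 2 := by
    rw [← Complex.exp_nat_mul]; congr 1; push_cast; ring
  have x2' : Complex.exp (w * (-2 : ℝ)) = Complex.exp (-w) ^ 2 := by
    rw [← Complex.exp_nat_mul]; congr 1; push_cast; ring
  have x1 : Complex.exp (w * (1 : ℝ)) = Complex.exp w := by simp
  have x1' : Complex.exp (w * (-1 : ℝ)) = Complex.exp (-w) := by simp
  have x0 : Complex.exp (w * (0 : ℝ)) = 1 := by simp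
  rw [x2, x2', x1, x1', x0]
  have hm : Complex.exp w * Complex.exp (-w) = 1 := by rw [← Complex.exp_add]; simp
  generalize Complex.exp w = X at *
  generalize Complex.exp (-w) = Y at *
  push_cast
  field_simp
  linear_combination (-72) * hm

theorem tsc_fourier (v : ℝ) (hv : v ≠ 0) :
    FourierTransform.fourier (fun t : ℝ => (triangleSelfConv t : ℂ)) v =
      (((2 * (1 - cos (2 * π * v)) / (2 * π * v) ^ 2) ^ 2 : ℝ) : ℂ) := by
  rw [Real.fourier_real_eq_integral_exp_smul]
  have hp : (π : ℂ) ≠ 0 := by exact_mod_cast Real.pi_ne_zero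
  have hv' : (v : ℂ) ≠ 0 := by exact_mod_cast hv
  have hw : (-(2 * π * v) * Complex.I : ℂ) ≠ 0 := by simp [hp, hv']
  have := tsc_int _ hw
  calc _ = ∫ t : ℝ, Complex.exp (-(2 * π * v) * Complex.I * t) * (triangleSelfConv t : ℂ) := by
        congr 1; ext t; rw [smul_eq_mul]; congr 2; push_cast; ring
    _ = _ := by
        rw [this]
        have hc : Complex.exp (-(2 * π * v) * Complex.I) + Complex.exp (-(-(2 * π * v) * Complex.I))
            = 2 * Complex.cos (2 * π * v) := by
          rw [Complex.two_cos]; rw [add_comm]; congr 2; ring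
        rw [hc]
        push_cast
        rw [mul_pow (-(2 * π * v : ℂ)), Complex.I_sq]
        field_simp
        ring

theorem tsc_integrable : Integrable (fun t : ℝ => (triangleSelfConv t : ℂ)) := by
  apply Continuous.integrable_of_hasCompactSupport
  · have := tsc_cont
    fun_prop
  · apply HasCompactSupport.of_support_subset_isCompact (isCompact_Icc (a := (-2 : ℝ)) (b := 2))
    intro t ht
    rw [Function.mem_support] at ht
    by_contra hc
    apply ht
    rw [tsc_zero t]
    · simp
    · by_contra hlt
      rw [not_le, abs_lt] at hlt
      exact hc ⟨hlt.1.le, hlt.2.le⟩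

theorem tsc_fourier_integrable :
    Integrable (FourierTransform.fourier (fun t : ℝ => (triangleSelfConv t : ℂ))) := by
  have hc : Continuous (FourierTransform.fourier (fun t : ℝ => (triangleSelfConv t : ℂ))) :=
    VectorFourier.fourierIntegral_continuous Real.continuous_fourierChar
      (by exact continuous_inner) tsc_integrable
  refine (integrable_inv_one_add_sq.const_mul 2).mono' hc.aestronglyMeasurable ?_
  have hne : ∀ᵐ v : ℝ, v ≠ 0 := by simp [ae_iff]
  filter_upwards [hne] with v hv
  rw [tsc_fourier v hv, Complex.norm_real, Real.norm_eq_abs, abs_of_nonneg (by positivity)]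
  have hs : (2 * π * v) ≠ 0 := by have := Real.pi_ne_zero; positivity
  have hs1 : 4 * v ^ 2 ≤ (2 * π * v) ^ 2 := by
    nlinarith [Real.pi_gt_three, sq_nonneg v, mul_nonneg (sq_nonneg v) (by nlinarith [Real.pi_gt_three] : 0 ≤ 4 * π ^ 2 - 4)]
  have c1 := Real.one_sub_sq_div_two_le_cos (x := 2 * π * v)
  have c2 := Real.neg_one_le_cos (2 * π * v)
  have c3 := Real.cos_le_one (2 * π * v)
  have hspos : 0 < (2 * π * v) ^ 2 := by positivity
  generalize (2 * π * v) = s at *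
  rw [← div_eq_mul_inv, div_pow, div_le_div_iff₀ (by positivity) (by positivity)]
  generalize cos s = c at *
  have a1 : (2 * (1 - c)) ^ 2 ≤ (s ^ 2) ^ 2 := by
    apply pow_le_pow_left₀ <;> linarith
  have a2 : (2 * (1 - c)) ^ 2 ≤ 4 * s ^ 2 := by nlinarith
  have a3 : (2 * (1 - c)) ^ 2 * v ^ 2 ≤ 4 * s ^ 2 * v ^ 2 :=
    mul_le_mul_of_nonneg_right a2 (sq_nonneg v)
  have a4 : s ^ 2 * (4 * v ^ 2) ≤ s ^ 2 * s ^ 2 := mul_le_mul_of_nonneg_left hs1 (sq_nonneg s)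
  nlinarith

theorem main_char (f : ℝ → ℝ) (hf : ∀ x : ℝ, x ≠ 0 → f x = (1 - cos x) / (π * x ^ 2))
    (h : ℝ → ℝ) (hh : ∀ x, h x = (3 * π ^ 2 / 4) * (f (π * x / 4)) ^ 2) (t : ℝ) :
    (∫ x : ℝ, (h x : ℂ) * Complex.exp (Complex.I * t * x)) =
      (((3 / 2) * triangleSelfConv (4 * t / π) : ℝ) : ℂ) := by
  have hp := Real.pi_ne_zero
  have hcont : Continuous (fun t : ℝ => (triangleSelfConv t : ℂ)) := by
    have := tsc_cont
    fun_prop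
  have inv := congrFun (hcont.fourierInv_fourier_eq tsc_integrable tsc_fourier_integrable) (4 * t / π)
  rw [Real.fourierInv_eq'] at inv
  have sub := Measure.integral_comp_mul_left
    (fun x : ℝ => (h x : ℂ) * Complex.exp (Complex.I * t * x)) 8
  have hne : ∀ᵐ v : ℝ, v ≠ 0 := by simp [ae_iff]
  have e : (∫ v : ℝ, (h (8 * v) : ℂ) * Complex.exp (Complex.I * t * ((8 * v : ℝ) : ℂ))) =
      ∫ v : ℝ, (3 / 16 : ℂ) * (Complex.exp ((↑(2 * π * inner ℝ v (4 * t / π)) * Complex.I)) •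
        FourierTransform.fourier (fun t : ℝ => (triangleSelfConv t : ℂ)) v) := by
    apply integral_congr_ae
    filter_upwards [hne] with v hv
    rw [tsc_fourier v hv, hh, show π * (8 * v) / 4 = 2 * π * v by ring,
      hf _ (by positivity)]
    have e1 : (Complex.I * t * ((8 * v : ℝ) : ℂ)) = (↑(2 * π * inner ℝ v (4 * t / π)) * Complex.I) := by
      have : 2 * π * inner ℝ v (4 * t / π) = 8 * v * t := by
        rw [real_inner_comm, RCLike.inner_apply, conj_trivial]
        field_simp
        try ring
      rw [this]; push_cast; ring
    rw [e1, smul_eq_mul]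
    have e2 : 3 * π ^ 2 / 4 * ((1 - cos (2 * π * v)) / (π * (2 * π * v) ^ 2)) ^ 2 =
        3 / 16 * (2 * (1 - cos (2 * π * v)) / (2 * π * v) ^ 2) ^ 2 := by
      field_simp
      try ring
    rw [e2]; push_cast; ring
  rw [e, integral_const_mul, inv] at sub
  rw [abs_of_pos (by norm_num), Complex.real_smul] at sub
  push_cast at sub ⊢
  linear_combination (-8) * sub

/-- Let `f(0) = 1/(2π)`, `f(x) = (1 − cos x)/(πx²)` for `x ≠ 0`, and let
`g` be as in `triangleSelfConv`.  Then `h(x) = (3π²/4)·f(πx/4)²` is a probability density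
whose characteristic function is `ψ(t) = (3/2)·g(4t/π)`; moreover `ψ` is non-negative,
vanishes for `|t| ≥ π/2`, is twice differentiable, and `ψ''(0) = −48/π²`. -/
theorem explicit_minimal_psi
    (f : ℝ → ℝ) (hf0 : f 0 = 1 / (2 * π))
    (hf : ∀ x : ℝ, x ≠ 0 → f x = (1 - cos x) / (π * x ^ 2))
    (h : ℝ → ℝ) (hh : ∀ x, h x = (3 * π ^ 2 / 4) * (f (π * x / 4)) ^ 2)
    (ψ : ℝ → ℝ) (hψdef : ∀ t, ψ t = (3 / 2) * triangleSelfConv (4 * t / π)) :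
    -- h is a probability density function
    (∀ x, 0 ≤ h x) ∧ (∫ x : ℝ, h x) = 1 ∧
    -- whose characteristic function is ψ
    (∀ t : ℝ, (∫ x : ℝ, (h x : ℂ) * Complex.exp (Complex.I * t * x)) = (ψ t : ℂ)) ∧
    -- ψ is non-negative and vanishes for |t| ≥ π/2
    (∀ t, 0 ≤ ψ t) ∧ (∀ t : ℝ, π / 2 ≤ |t| → ψ t = 0) ∧
    -- ψ is twice differentiable with ψ''(0) = −48/π²
    Differentiable ℝ ψ ∧ Differentiable ℝ (deriv ψ) ∧
    deriv (deriv ψ) 0 = -(48 / π ^ 2) := by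
  have hp := Real.pi_pos
  have hchar : ∀ t : ℝ, (∫ x : ℝ, (h x : ℂ) * Complex.exp (Complex.I * t * x)) = (ψ t : ℂ) := by
    intro t; rw [hψdef]; exact main_char f hf h hh t
  have hψ : ψ = fun t => (3 / 2) * triangleSelfConv (4 / π * t) := by
    ext t; rw [hψdef]; congr 2; ring
  have d1 : ∀ t, HasDerivAt ψ ((6 / π) * tscD (4 / π * t)) t := by
    intro t
    rw [hψ]
    have h1 : HasDerivAt (fun t : ℝ => 4 / π * t) (4 / π) t := by
      simpa using (hasDerivAt_id t).const_mul (4 / π)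
    refine (((tsc_deriv (4 / π * t)).comp t h1).const_mul (3 / 2)).congr_deriv ?_
    ring
  have hd : deriv ψ = fun t => (6 / π) * tscD (4 / π * t) := funext fun t => (d1 t).deriv
  have d2 : ∀ t, HasDerivAt (deriv ψ) ((24 / π ^ 2) * tscDD (4 / π * t)) t := by
    intro t
    rw [hd]
    have h1 : HasDerivAt (fun t : ℝ => 4 / π * t) (4 / π) t := by
      simpa using (hasDerivAt_id t).const_mul (4 / π)
    refine (((tscD_deriv (4 / π * t)).comp t h1).const_mul (6 / π)).congr_deriv ?_
    field_simp
    try ring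
  refine ⟨fun x => ?_, ?_, hchar, fun t => ?_, fun t ht => ?_, fun t => (d1 t).differentiableAt,
    fun t => (d2 t).differentiableAt, ?_⟩
  · rw [hh]; positivity
  · have h0 := hchar 0
    have hz : ψ 0 = 1 := by
      rw [hψdef]; unfold triangleSelfConv; norm_num
    simp only [Complex.ofReal_zero, mul_zero, zero_mul, Complex.exp_zero, mul_one, hz] at h0
    rw [integral_complex_ofReal] at h0
    exact_mod_cast h0
  · rw [hψdef]; have := tsc_nonneg (4 * t / π); positivity
  · rw [hψdef, tsc_zero, mul_zero]
    rw [abs_div, abs_mul, abs_of_pos hp, le_div_iff₀ hp]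
    norm_num
    linarith
  · rw [(d2 0).deriv]
    unfold tscDD
    rw [mul_zero]
    norm_num
    ring
end

section
/- Call a pmf p on ℤ light-tailed if there exist constants C > 0 and λ > 1 such that p(k) ≤ C·λ^{−|k|} for all sufficiently large |k|. Let X, Y be i.i.d. uniform {0,1}-valued random variables and let U, V be ℤ-valued random variables jointly distributed with X, Y, each having a light-tailed pmf. Then properties (S1)–(S3) cannot all be satisfied: if (U,X) is independent of (V,Y), U+V is independent of X, and U+V is independent of Y, then U is independent of X, V is independent of Y, and U+V is independent of X⊕Y, so X⊕Y cannot be almost surely determined by U+V. -/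
open MeasureTheory ProbabilityTheory

/-- A pmf `p` on `ℤ` is light-tailed if `p(k) ≤ C λ^{-|k|}` for some `C > 0`, `λ > 1`, and
all sufficiently large `|k|`. -/
def LightTailed (p : ℤ → ℝ) : Prop :=
  ∃ C > (0 : ℝ), ∃ lam > (1 : ℝ), ∃ N : ℕ, ∀ k : ℤ, (N : ℤ) ≤ |k| → p k ≤ C * lam ^ (-|k|)


lemma zmod_two_indep {Ω : Type*} [MeasurableSpace Ω] (μ : Measure Ω) [IsProbabilityMeasure μ]
    (X : Ω → ZMod 2) (U : Ω → ℤ) (hX : Measurable X)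
    (h : ∀ s : Set ℤ, μ (U ⁻¹' s ∩ X ⁻¹' {0}) = μ (U ⁻¹' s ∩ X ⁻¹' {1})) :
    IndepFun U X μ ∧ ∀ a, μ (X ⁻¹' {a}) = 1 / 2 := by
  have hsplit : ∀ s : Set ℤ, μ (U ⁻¹' s) = μ (U ⁻¹' s ∩ X ⁻¹' {0}) + μ (U ⁻¹' s ∩ X ⁻¹' {1}) := by
    intro s
    rw [← measure_inter_add_sdiff (U ⁻¹' s) (hX (measurableSet_singleton (0 : ZMod 2)))]
    congr 2
    ext ω
    have : ∀ x : ZMod 2, x ≠ 0 ↔ x = 1 := by decide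
    simp [this]
  have hhalf : ∀ s : Set ℤ, ∀ a : ZMod 2, μ (U ⁻¹' s ∩ X ⁻¹' {a}) = μ (U ⁻¹' s) * (1 / 2) := by
    intro s a
    have h0 : μ (U ⁻¹' s ∩ X ⁻¹' {0}) = μ (U ⁻¹' s) * (1 / 2) := by
      rw [hsplit s, ← h s, ← two_mul, mul_comm, ← mul_assoc, one_div,
        ENNReal.inv_mul_cancel (by simp) (by simp), one_mul]
    have : a = 0 ∨ a = 1 := by revert a; decide
    rcases this with rfl | rfl
    · exact h0
    · rw [← h s, h0]
  have hu : ∀ a, μ (X ⁻¹' {a}) = 1 / 2 := by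
    intro a
    have := hhalf Set.univ a
    simpa using this
  refine ⟨?_, hu⟩
  rw [indepFun_iff_measure_inter_preimage_eq_mul]
  intro s t _ _
  have ht : t = ∅ ∨ t = Set.univ ∨ ∃ a, t = {a} := by
    have e : ∀ x : ZMod 2, x = 0 ∨ x = 1 := by decide
    by_cases h0 : (0 : ZMod 2) ∈ t <;> by_cases h1 : (1 : ZMod 2) ∈ t
    · right; left
      ext x; rcases e x with rfl | rfl <;> simp [h0, h1]
    · right; right; refine ⟨0, ?_⟩
      ext x; rcases e x with rfl | rfl <;> simp [h0, h1]
    · right; right; refine ⟨1, ?_⟩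
      ext x; rcases e x with rfl | rfl <;> simp [h0, h1]
    · left
      ext x; rcases e x with rfl | rfl <;> simp [h0, h1]
  rcases ht with rfl | rfl | ⟨a, rfl⟩
  · simp
  · simp
  · rw [hhalf, hu]

lemma summable_exp_neg_abs {ε : ℝ} (hε : 0 < ε) :
    Summable (fun k : ℤ => Real.exp (-ε * |(k : ℝ)|)) := by
  have h : Summable (fun n : ℕ => Real.exp (-ε * |((n : ℤ) : ℝ)|)) := by
    have := Real.summable_exp_nat_mul_iff.2 (neg_lt_zero.2 hε)
    refine this.congr fun n => ?_
    simp [mul_comm]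
  refine Summable.of_nat_of_neg h (h.congr fun n => ?_)
  simp

lemma lightTailed_zero_mem {Ω : Type*} [MeasurableSpace Ω] (μ : Measure Ω)
    [IsProbabilityMeasure μ] (V : Ω → ℤ) (hV : Measurable V)
    (h : LightTailed (fun k => (μ (V ⁻¹' {k})).toReal)) :
    (0 : ℝ) ∈ interior (integrableExpSet (fun ω => (V ω : ℝ)) μ) := by
  obtain ⟨C, hC, lam, hlam, N, hN⟩ := h
  set ε := Real.log lam / 2 with hεdef
  have hε : 0 < ε := by have := Real.log_pos hlam; positivity
  have hsum : Summable (fun k : ℤ => Real.exp (ε * |(k : ℝ)|) * (μ (V ⁻¹' {k})).toReal) := by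
    refine Summable.of_norm_bounded_eventually ((summable_exp_neg_abs hε).mul_left C) ?_
    have hfin : {k : ℤ | ¬ (N : ℤ) ≤ |k|}.Finite := by
      refine (Set.finite_Icc (-(N : ℤ)) N).subset ?_
      intro k hk
      simp only [Set.mem_ofPred_eq, not_le, abs_lt] at hk
      exact ⟨hk.1.le, hk.2.le⟩
    have hev : ∀ᶠ k : ℤ in Filter.cofinite, (N : ℤ) ≤ |k| := hfin
    filter_upwards [hev] with k hk
    have h1 := hN k hk
    have h2 : lam ^ (-|k|) = Real.exp (-(2 * ε) * |(k : ℝ)|) := by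
      rw [← Real.rpow_intCast, Real.rpow_def_of_pos (by linarith)]
      congr 1
      push_cast
      rw [hεdef]; ring
    rw [Real.norm_of_nonneg (by positivity)]
    calc Real.exp (ε * |(k : ℝ)|) * (μ (V ⁻¹' {k})).toReal
        ≤ Real.exp (ε * |(k : ℝ)|) * (C * lam ^ (-|k|)) := by gcongr
      _ = C * Real.exp (-ε * |(k : ℝ)|) := by
        rw [h2, mul_left_comm, ← Real.exp_add]; congr 2; ring
  have hint : Integrable (fun k : ℤ => Real.exp (ε * |(k : ℝ)|)) (μ.map V) := by
    refine ⟨measurable_from_top.aestronglyMeasurable, ?_⟩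
    rw [hasFiniteIntegral_iff_ofReal (Filter.Eventually.of_forall fun k => (Real.exp_pos _).le),
      lintegral_countable']
    have := hsum.tsum_ofReal_lt_top
    refine lt_of_eq_of_lt (tsum_congr fun k => ?_) this
    rw [ENNReal.ofReal_mul (Real.exp_pos _).le, ENNReal.ofReal_toReal (measure_ne_top _ _),
      Measure.map_apply hV (measurableSet_singleton k)]
  have hint2 : Integrable (fun ω => Real.exp (ε * |(V ω : ℝ)|)) μ := hint.comp_measurable hV
  rw [mem_interior]
  refine ⟨Set.Ioo (-ε) ε, ?_, isOpen_Ioo, by simp [hε]⟩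
  intro t ht
  change Integrable _ μ
  refine hint2.mono' ?_ (Filter.Eventually.of_forall fun ω => ?_)
  · have : Measurable (fun k : ℤ => Real.exp (t * (k : ℝ))) := measurable_from_top
    exact (this.comp hV).aestronglyMeasurable
  · rw [Real.norm_of_nonneg (Real.exp_pos _).le]
    apply Real.exp_le_exp.2
    calc t * (V ω : ℝ) ≤ |t * (V ω : ℝ)| := le_abs_self _
      _ = |t| * |(V ω : ℝ)| := abs_mul _ _
      _ ≤ ε * |(V ω : ℝ)| := by gcongr; exact (abs_lt.2 ht).le

lemma analytic_cancel (f g q : ℝ → ℂ) (hf : Continuous f) (hg : Continuous g)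
    (hq : AnalyticOnNhd ℝ q Set.univ) (h0 : q 0 ≠ 0) (h : ∀ t, f t * q t = g t * q t) :
    f = g := by
  funext t
  by_contra hne
  have hev : ∀ᶠ s in nhds t, f s ≠ g s :=
    (isOpen_ne_fun hf hg).mem_nhds hne
  have hz : q =ᶠ[nhds t] 0 := by
    filter_upwards [hev] with s hs
    have := h s
    by_contra hqs
    exact hs (mul_right_cancel₀ hqs this)
  have := hq.eqOn_zero_of_preconnected_of_eventuallyEq_zero isPreconnected_univ
    (Set.mem_univ t) hz
  exact h0 (this (Set.mem_univ 0))

lemma key_half {Ω : Type*} [MeasurableSpace Ω] (μ : Measure Ω) [IsProbabilityMeasure μ]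
    (X : Ω → ZMod 2) (U V : Ω → ℤ)
    (hX : Measurable X) (hU : Measurable U) (hV : Measurable V)
    (hXunif : ∀ a : ZMod 2, μ (X ⁻¹' {a}) = 1 / 2)
    (hVlt : LightTailed (fun k => (μ (V ⁻¹' {k})).toReal))
    (hS1 : IndepFun (fun ω => (U ω, X ω)) V μ)
    (hS2 : IndepFun (fun ω => U ω + V ω) X μ) (s : Set ℤ) :
    μ (U ⁻¹' s ∩ X ⁻¹' {0}) = μ (U ⁻¹' s ∩ X ⁻¹' {1}) := by
  have hc : Measurable (fun k : ℤ => (k : ℝ)) := measurable_from_top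
  have hUr : Measurable (fun ω => (U ω : ℝ)) := hc.comp hU
  have hVr : Measurable (fun ω => (V ω : ℝ)) := hc.comp hV
  let ν : ZMod 2 → Measure ℝ := fun a => (μ.restrict (X ⁻¹' {a})).map (fun ω => (U ω : ℝ))
  let e : ℝ → ℤ → ℂ := fun t k => Complex.exp (t * (k : ℝ) * Complex.I)
  let i : ZMod 2 → ZMod 2 → ℂ := fun a x => if x = a then 1 else 0
  have he : ∀ t, Measurable (e t) := fun t => measurable_from_top
  have hi : ∀ a, Measurable (i a) := fun a => measurable_from_top
  have hm : ∀ a (F : Ω → ℂ), ∫ ω in X ⁻¹' {a}, F ω ∂μ = ∫ ω, i a (X ω) * F ω ∂μ := by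
    intro a F
    rw [← integral_indicator (hX (measurableSet_singleton a))]
    congr 1
    ext ω
    by_cases h : X ω = a <;> simp [i, h]
  have hν : ∀ a t, charFun (ν a) t = ∫ ω, i a (X ω) * e t (U ω) ∂μ := by
    intro a t
    rw [charFun_apply_real, integral_map hUr.aemeasurable (by fun_prop), hm]
  let q : ℝ → ℂ := fun t => complexMGF (fun ω => (V ω : ℝ)) μ (t * Complex.I)
  have hq : ∀ t, q t = ∫ ω, e t (V ω) ∂μ := by
    intro t
    simp only [q, complexMGF, e]
    congr 1; ext ω; congr 1; ring
  have hprod : ∀ a t, charFun (ν a) t * q t = (1 / 2 : ℂ) * ∫ ω, e t (U ω + V ω) ∂μ := by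
    intro a t
    have hpair : Measurable (fun p : ℤ × ZMod 2 => i a p.2 * e t p.1) :=
      ((hi a).comp measurable_snd).mul ((he t).comp measurable_fst)
    have h1 := (hS1.comp hpair (he t)).integral_fun_mul_eq_mul_integral
      (hpair.comp (hU.prodMk hX)).aestronglyMeasurable ((he t).comp hV).aestronglyMeasurable
    have h2 := (hS2.symm.comp (hi a) (he t)).integral_fun_mul_eq_mul_integral
      ((hi a).comp hX).aestronglyMeasurable ((he t).comp (hU.add hV)).aestronglyMeasurable
    have h3 : ∫ ω, i a (X ω) ∂μ = 1 / 2 := by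
      have := hm a (fun _ => 1)
      simp only [mul_one] at this
      rw [← this]
      simp [Measure.real, hXunif]
    simp only [Function.comp_def] at h1 h2
    rw [hν, hq, ← h1, ← h3, ← h2]
    congr 1; ext ω
    rw [mul_assoc]
    congr 1
    simp only [e]
    rw [← Complex.exp_add]
    congr 1; push_cast; ring
  have hanal : AnalyticOnNhd ℝ q Set.univ := by
    intro t _
    have h0 : AnalyticAt ℂ (complexMGF (fun ω => (V ω : ℝ)) μ) ((t : ℂ) * Complex.I) := by
      apply analyticAt_complexMGF
      simpa using lightTailed_zero_mem μ V hV hVlt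
    have h1 : AnalyticAt ℝ (fun t : ℝ => (t : ℂ) * Complex.I) t :=
      (Complex.ofRealCLM.analyticAt t).mul analyticAt_const
    exact AnalyticAt.fun_comp (f := fun t : ℝ => (t : ℂ) * Complex.I) h0.restrictScalars h1
  have heq : charFun (ν 0) = charFun (ν 1) := by
    refine analytic_cancel _ _ q continuous_charFun continuous_charFun hanal ?_ ?_
    · simp [q, complexMGF]
    · intro t; rw [hprod, hprod]
  have hνeq : ν 0 = ν 1 := Measure.ext_of_charFun heq
  have hs : MeasurableSet ((fun k : ℤ => (k : ℝ)) '' s) := (s.to_countable.image _).measurableSet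
  have happ : ∀ a, ν a ((fun k : ℤ => (k : ℝ)) '' s) = μ (U ⁻¹' s ∩ X ⁻¹' {a}) := by
    intro a
    simp only [ν]
    rw [Measure.map_apply hUr hs, Measure.restrict_apply (hUr hs)]
    congr 2
    ext ω
    simp
  rw [← happ, ← happ, hνeq]

/-- Let `X, Y` be i.i.d. uniform `{0,1}`-valued random variables and
`U, V` be `ℤ`-valued random variables, each with a light-tailed pmf, jointly distributed
with `X, Y`.  Then (S1)–(S3) cannot all hold: if `(U,X) ⫫ (V,Y)`, `U+V ⫫ X` and
`U+V ⫫ Y`, then `U ⫫ X`, `V ⫫ Y` and `U+V ⫫ X⊕Y`, so `X⊕Y` cannot be almost surely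
determined by `U+V`. -/
theorem no_light_tailed_secure_xor
    {Ω : Type*} [MeasurableSpace Ω] (μ : Measure Ω) [IsProbabilityMeasure μ]
    (X Y : Ω → ZMod 2) (U V : Ω → ℤ)
    (hX : Measurable X) (hY : Measurable Y) (hUm : Measurable U) (hVm : Measurable V)
    -- X and Y are i.i.d. uniform on {0,1}
    (hXY : IndepFun X Y μ)
    (hXunif : ∀ a : ZMod 2, μ (X ⁻¹' {a}) = 1 / 2)
    (hYunif : ∀ a : ZMod 2, μ (Y ⁻¹' {a}) = 1 / 2)
    -- the pmfs of U and V are light-tailed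
    (hUlt : LightTailed (fun k => (μ (U ⁻¹' {k})).toReal))
    (hVlt : LightTailed (fun k => (μ (V ⁻¹' {k})).toReal))
    -- (S1)
    (hS1 : IndepFun (fun ω => (U ω, X ω)) (fun ω => (V ω, Y ω)) μ)
    -- (S2)
    (hS2X : IndepFun (fun ω => U ω + V ω) X μ)
    (hS2Y : IndepFun (fun ω => U ω + V ω) Y μ) :
    IndepFun U X μ ∧ IndepFun V Y μ ∧
    IndepFun (fun ω => U ω + V ω) (fun ω => X ω + Y ω) μ ∧
      ¬ ∃ g : ℤ → ZMod 2, ∀ᵐ ω ∂μ, X ω + Y ω = g (U ω + V ω) := by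
  have hUX := fun s => key_half μ X U V hX hUm hVm hXunif hVlt
    (hS1.comp measurable_id measurable_fst) hS2X s
  have hVY := fun s => key_half μ Y V U hY hVm hUm hYunif hUlt
    (hS1.symm.comp measurable_id measurable_fst) (by simpa only [add_comm] using hS2Y) s
  have hi1 := (zmod_two_indep μ X U hX hUX).1
  have hi2 := (zmod_two_indep μ Y V hY hVY).1
  have hXY1 : Measurable (fun ω => X ω + Y ω) :=
    (measurable_of_countable (fun p : ZMod 2 × ZMod 2 => p.1 + p.2)).comp (hX.prodMk hY)
  have hshift : Measurable (fun x : ZMod 2 => x + 1) := measurable_from_top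
  have hX1 : Measurable (fun ω => X ω + 1) := hshift.comp hX
  have hlawX : μ.map (fun ω => X ω + 1) = μ.map X := by
    refine Measure.ext_of_singleton fun a => ?_
    rw [Measure.map_apply hX1 (measurableSet_singleton a),
      Measure.map_apply hX (measurableSet_singleton a), hXunif]
    have : (fun ω => X ω + 1) ⁻¹' {a} = X ⁻¹' {a - 1} := by
      ext ω; simp [eq_sub_iff_add_eq]
    rw [this, hXunif]
  have hlaw1 : μ.map (fun ω => (U ω, X ω + 1)) = μ.map (fun ω => (U ω, X ω)) := by
    rw [(indepFun_iff_map_prod_eq_prod_map_map hUm.aemeasurable hX.aemeasurable).1 hi1,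
      (indepFun_iff_map_prod_eq_prod_map_map hUm.aemeasurable hX1.aemeasurable).1
        (hi1.comp measurable_id hshift), hlawX]
  have hlaw2 : μ.map (fun ω => ((U ω, X ω + 1), (V ω, Y ω))) =
      μ.map (fun ω => ((U ω, X ω), (V ω, Y ω))) := by
    rw [(indepFun_iff_map_prod_eq_prod_map_map (hUm.prodMk hX).aemeasurable
        (hVm.prodMk hY).aemeasurable).1 hS1,
      (indepFun_iff_map_prod_eq_prod_map_map (hUm.prodMk hX1).aemeasurable
        (hVm.prodMk hY).aemeasurable).1
        (hS1.comp (φ := fun p : ℤ × ZMod 2 => (p.1, p.2 + 1))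
          (measurable_fst.prodMk (hshift.comp measurable_snd)) measurable_id), hlaw1]
  have hZ : ∀ s : Set ℤ, μ ((fun ω => U ω + V ω) ⁻¹' s ∩ (fun ω => X ω + Y ω) ⁻¹' {0}) =
      μ ((fun ω => U ω + V ω) ⁻¹' s ∩ (fun ω => X ω + Y ω) ⁻¹' {1}) := by
    intro s
    let A : Set ((ℤ × ZMod 2) × (ℤ × ZMod 2)) :=
      {p | p.1.1 + p.2.1 ∈ s ∧ p.1.2 + p.2.2 = 1}
    have hA : MeasurableSet A := A.to_countable.measurableSet
    have h := congrArg (fun m => m A) hlaw2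
    rw [Measure.map_apply ((hUm.prodMk hX1).prodMk (hVm.prodMk hY)) hA,
      Measure.map_apply ((hUm.prodMk hX).prodMk (hVm.prodMk hY)) hA] at h
    convert h using 2
    · ext ω
      have : ∀ x y : ZMod 2, x + y = 0 ↔ x + 1 + y = 1 := by decide
      simp only [A, Set.mem_inter_iff, Set.mem_preimage, Set.mem_singleton_iff, this]
      rfl
    · ext ω
      rfl
  obtain ⟨hi3, hu3⟩ := zmod_two_indep μ (fun ω => X ω + Y ω) (fun ω => U ω + V ω) hXY1 hZ
  refine ⟨hi1, hi2, hi3, ?_⟩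
  rintro ⟨g, hg⟩
  have h1 := indepFun_iff_measure_inter_preimage_eq_mul.1 hi3 (g ⁻¹' {1}) {0}
    trivial (measurableSet_singleton _)
  have h2 : μ ((fun ω => U ω + V ω) ⁻¹' (g ⁻¹' {1}) ∩ (fun ω => X ω + Y ω) ⁻¹' {0}) = 0 := by
    refine measure_mono_null ?_ (ae_iff.1 hg)
    rintro ω ⟨ha, hb⟩
    simp only [Set.mem_preimage, Set.mem_singleton_iff] at ha hb
    simp [ha, hb]
  have h3 : μ ((fun ω => U ω + V ω) ⁻¹' (g ⁻¹' {1})) = μ ((fun ω => X ω + Y ω) ⁻¹' {1}) := by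
    refine measure_congr ?_
    filter_upwards [hg] with ω hω
    apply propext
    change g (U ω + V ω) = 1 ↔ X ω + Y ω = 1
    rw [hω]
  rw [h2, h3, hu3, hu3] at h1
  simp at h1
end

section
/- Let Λ₀ ⊆ Λ be full-rank nested lattices in ℝ^d, with Λ₀ of index N in Λ and cosets Λ_0, …, Λ_{N−1} forming the group G = Λ/Λ₀. Let X, Y be i.i.d. uniform over G. For each j, let p_j be a pmf supported within the coset Λ_j with characteristic function φ_j(ζ) = Σ_{k∈Λ_j} p_j(k) e^{i⟨ζ,k⟩}, and set φ_U = φ_V = (1/N) Σ_{j=0}^{N−1} φ_j. Suppose φ_U φ_V = φ_j φ_V = φ_U φ_j pointwise for every j = 0, 1, …, N−1. Then the random variables (U, V, X, Y) with joint pmf p(k, l, Λ_i, Λ_j) = (1/N²) p_i(k) p_j(l) for k, l ∈ Λ and Λ_i, Λ_j ∈ G satisfy: (S1) (U,X) is independent of (V,Y); (S2) U+V is independent of X and U+V is independent of Y; (S3) the coset of Λ₀ containing U+V equals X⊕Y almost surely. -/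
open MeasureTheory ProbabilityTheory Real RealInnerProductSpace

/-- The full-rank lattice in `ℝ^d` with generator matrix `A`, i.e. `A^T ℤ^d`. -/
def latticeOfGen {d : ℕ} (A : Matrix (Fin d) (Fin d) ℝ) : Set (EuclideanSpace ℝ (Fin d)) :=
  {x | ∃ z : Fin d → ℤ, ∀ i, x i = A.transpose.mulVec (fun j => (z j : ℝ)) i}

/-- The characteristic function `φ_j(ζ) = Σ_{k ∈ Λ_j} p_j(k) e^{i⟨ζ,k⟫}` of a pmf `p_j`
supported within the coset `Λ_j = u_j + Λ₀` (with `Λ₀ = A₀^T ℤ^d`). -/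
noncomputable def cosetCharFun {d : ℕ} (A0 : Matrix (Fin d) (Fin d) ℝ)
    (uj : EuclideanSpace ℝ (Fin d)) (pj : EuclideanSpace ℝ (Fin d) → ℝ)
    (ζ : EuclideanSpace ℝ (Fin d)) : ℂ :=
  ∑' k : ↥{x : EuclideanSpace ℝ (Fin d) | x - uj ∈ latticeOfGen A0},
    (pj k : ℂ) * Complex.exp (Complex.I * (⟪ζ, (k : EuclideanSpace ℝ (Fin d))⟫ : ℝ))


open scoped ENNReal

lemma latticeOfGen_countable {d : ℕ} (A : Matrix (Fin d) (Fin d) ℝ) :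
    (latticeOfGen A).Countable := by
  have : latticeOfGen A ⊆ Set.range (fun z : Fin d → ℤ =>
      WithLp.toLp 2 (A.transpose.mulVec (fun j => (z j : ℝ)))) := by
    rintro x ⟨z, hz⟩
    refine ⟨z, ?_⟩
    ext i
    exact (hz i).symm
  exact (Set.countable_range _).mono this

lemma coset_countable {d : ℕ} (A : Matrix (Fin d) (Fin d) ℝ) (v : EuclideanSpace ℝ (Fin d)) :
    {x : EuclideanSpace ℝ (Fin d) | x - v ∈ latticeOfGen A}.Countable :=
  (latticeOfGen_countable A).preimage (sub_left_injective)

lemma add_mem_latticeOfGen {d : ℕ} {A : Matrix (Fin d) (Fin d) ℝ}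
    {x y : EuclideanSpace ℝ (Fin d)} (hx : x ∈ latticeOfGen A) (hy : y ∈ latticeOfGen A) :
    x + y ∈ latticeOfGen A := by
  obtain ⟨z, hz⟩ := hx
  obtain ⟨w, hw⟩ := hy
  refine ⟨z + w, fun i => ?_⟩
  have : (fun j => (((z + w) j : ℤ) : ℝ)) = (fun j => (z j : ℝ)) + (fun j => (w j : ℝ)) := by
    ext j; simp
  rw [this, Matrix.mulVec_add]
  simp [hz, hw]

lemma measure_eq_of_singleton {α : Type*} [MeasurableSpace α] [MeasurableSingletonClass α]
    (m₁ m₂ : Measure α) [IsProbabilityMeasure m₁] [IsProbabilityMeasure m₂] (C : Set α)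
    (hC : C.Countable) (h2 : m₂ Cᶜ = 0) (h : ∀ x, m₁ {x} = m₂ {x}) : m₁ = m₂ := by
  have key : ∀ s ⊆ C, m₁ s = m₂ s := by
    intro s hs
    have hsc := hC.mono hs
    have h1 : ∀ m : Measure α, m s = ∑' x : s, m {(x : α)} := by
      intro m
      conv_lhs => rw [← Set.biUnion_of_singleton s]
      rw [measure_biUnion hsc]
      · intro x _ y _ hxy
        simpa using hxy
      · intro x _; exact measurableSet_singleton x
    rw [h1, h1]
    exact tsum_congr fun x => h _
  have h1 : m₁ Cᶜ = 0 := by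
    rw [prob_compl_eq_zero_iff hC.measurableSet, key C subset_rfl]
    exact (prob_compl_eq_zero_iff hC.measurableSet).1 h2
  ext s hs
  rw [← measure_inter_conull h1, ← measure_inter_conull h2 , key _ Set.inter_subset_right]

/-- The law on `ℝ^d` with pmf `q` on the coset of `v`. -/
noncomputable def cosetLaw {d : ℕ} (A : Matrix (Fin d) (Fin d) ℝ)
    (v : EuclideanSpace ℝ (Fin d)) (q : EuclideanSpace ℝ (Fin d) → ℝ) :
    Measure (EuclideanSpace ℝ (Fin d)) :=
  Measure.sum (fun k : ↥{x : EuclideanSpace ℝ (Fin d) | x - v ∈ latticeOfGen A} =>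
    ENNReal.ofReal (q k) • Measure.dirac (k : EuclideanSpace ℝ (Fin d)))

lemma cosetLaw_prob {d : ℕ} (A : Matrix (Fin d) (Fin d) ℝ)
    (v : EuclideanSpace ℝ (Fin d)) (q : EuclideanSpace ℝ (Fin d) → ℝ)
    (hnn : ∀ k, 0 ≤ q k)
    (hsum : HasSum
      (fun k : ↥{x : EuclideanSpace ℝ (Fin d) | x - v ∈ latticeOfGen A} => q (k : _)) 1) : IsProbabilityMeasure (cosetLaw A v q) := by
  constructor
  rw [cosetLaw, Measure.sum_apply _ MeasurableSet.univ]
  simp only [Measure.smul_apply, measure_univ, smul_eq_mul, mul_one]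
  rw [← ENNReal.ofReal_tsum_of_nonneg (f := fun k : ↥{x : EuclideanSpace ℝ (Fin d) |
    x - v ∈ latticeOfGen A} => q (k : _)) (fun k => hnn k) hsum.summable, hsum.tsum_eq,
    ENNReal.ofReal_one]

lemma cosetLaw_singleton {d : ℕ} (A : Matrix (Fin d) (Fin d) ℝ)
    (v : EuclideanSpace ℝ (Fin d)) (q : EuclideanSpace ℝ (Fin d) → ℝ)
    (hsupp : ∀ k, q k ≠ 0 → k - v ∈ latticeOfGen A) (k : EuclideanSpace ℝ (Fin d)) :
    cosetLaw A v q {k} = ENNReal.ofReal (q k) := by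
  rw [cosetLaw, Measure.sum_apply _ (measurableSet_singleton k)]
  by_cases hk : k - v ∈ latticeOfGen A
  · rw [tsum_eq_single ⟨k, hk⟩]
    · simp
    · intro b hb
      have : (b : EuclideanSpace ℝ (Fin d)) ≠ k := fun h => hb (Subtype.ext h)
      simp [this]
  · have h0 : q k = 0 := by
      by_contra h; exact hk (hsupp k h)
    rw [h0, ENNReal.ofReal_zero, ENNReal.tsum_eq_zero]
    intro b
    have : (b : EuclideanSpace ℝ (Fin d)) ≠ k := by
      rintro rfl; exact hk b.2
    simp [this]

lemma cosetLaw_compl {d : ℕ} (A : Matrix (Fin d) (Fin d) ℝ)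
    (v : EuclideanSpace ℝ (Fin d)) (q : EuclideanSpace ℝ (Fin d) → ℝ) :
    cosetLaw A v q {x : EuclideanSpace ℝ (Fin d) | x - v ∈ latticeOfGen A}ᶜ = 0 := by
  rw [cosetLaw, Measure.sum_apply _ (coset_countable A v).measurableSet.compl,
    ENNReal.tsum_eq_zero]
  intro b
  simp [Measure.dirac_apply]

lemma charFun_cosetLaw {d : ℕ} (A : Matrix (Fin d) (Fin d) ℝ)
    (v : EuclideanSpace ℝ (Fin d)) (q : EuclideanSpace ℝ (Fin d) → ℝ)
    (hnn : ∀ k, 0 ≤ q k)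
    (hsum : HasSum
      (fun k : ↥{x : EuclideanSpace ℝ (Fin d) | x - v ∈ latticeOfGen A} => q (k : _)) 1) (ζ : EuclideanSpace ℝ (Fin d)) :
    charFun (cosetLaw A v q) ζ = cosetCharFun A v q ζ := by
  have := cosetLaw_prob A v q hnn hsum
  have hc : Countable ↥{x : EuclideanSpace ℝ (Fin d) | x - v ∈ latticeOfGen A} :=
    (coset_countable A v).to_subtype
  rw [charFun_apply, cosetLaw, cosetCharFun, integral_sum_measure]
  · refine tsum_congr fun k => ?_
    rw [integral_smul_measure, integral_dirac, ENNReal.toReal_ofReal (hnn _), Complex.real_smul,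
      real_inner_comm, mul_comm Complex.I]
  · refine Integrable.mono' (g := fun _ => (1 : ℝ)) ?_ ?_ ?_
    · exact integrable_const (μ := cosetLaw A v q) 1
    · exact Continuous.aestronglyMeasurable (by fun_prop)
    · refine Filter.Eventually.of_forall fun x => ?_
      rw [Complex.norm_exp_ofReal_mul_I]


lemma measure_eq_sum_fiber {Ω : Type*} [MeasurableSpace Ω] (μ : Measure Ω) {N : ℕ}
    (Z : Ω → Fin N) (hZ : Measurable Z) {s : Set Ω} (hs : MeasurableSet s) :
    μ s = ∑ i : Fin N, μ (s ∩ Z ⁻¹' {i}) := by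
  have h : s = ⋃ i ∈ (Finset.univ : Finset (Fin N)), (s ∩ Z ⁻¹' {i}) := by
    ext ω; simp
  conv_lhs => rw [h]
  refine measure_biUnion_finset ?_ ?_
  · intro i _ j _ hij
    refine Set.disjoint_left.2 fun ω h1 h2 => hij ?_
    exact h1.2.symm.trans h2.2
  · intro i _
    exact hs.inter (hZ (measurableSet_singleton i))

lemma indepFun_add_of_charFun {d N : ℕ} {Ω : Type*} [MeasurableSpace Ω] (μ : Measure Ω)
    [IsProbabilityMeasure μ] (hN : 0 < N)
    (X Y : Ω → Fin N) (U V : Ω → EuclideanSpace ℝ (Fin d))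
    (hX : Measurable X) (hY : Measurable Y) (hUm : Measurable U) (hVm : Measurable V)
    (hXunif : ∀ j, μ (X ⁻¹' {j}) = (N : ENNReal)⁻¹)
    (hind : IndepFun (fun ω => (U ω, X ω)) (fun ω => (V ω, Y ω)) μ)
    (c : EuclideanSpace ℝ (Fin d) → ℂ)
    (hc : ∀ i ζ, charFun ((μ.restrict (X ⁻¹' {i})).map U) ζ * charFun (μ.map V) ζ = c ζ) :
    IndepFun (fun ω => U ω + V ω) X μ := by
  have hN0 : (N : ENNReal) ≠ 0 := by exact_mod_cast hN.ne'
  have hNt : (N : ENNReal) ≠ ⊤ := ENNReal.natCast_ne_top N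
  have hsum : Measurable (fun ω => U ω + V ω) := hUm.add hVm
  have hprod : ∀ i, ((μ.restrict (X ⁻¹' {i})).map U).prod (μ.map V) =
      (μ.restrict (X ⁻¹' {i})).map (fun ω => (U ω, V ω)) := by
    intro i
    refine Measure.prod_eq fun s t hs ht => ?_
    rw [Measure.map_apply (hUm.prodMk hVm) (hs.prod ht),
      Measure.restrict_apply ((hUm.prodMk hVm) (hs.prod ht)), Measure.map_apply hUm hs,
      Measure.restrict_apply (hUm hs), Measure.map_apply hVm ht]
    have h := hind.measure_inter_preimage_eq_mul (s ×ˢ {i}) (t ×ˢ Set.univ)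
      (hs.prod (measurableSet_singleton i)) (ht.prod MeasurableSet.univ)
    have e1 : (fun ω => (U ω, X ω)) ⁻¹' s ×ˢ {i} = U ⁻¹' s ∩ X ⁻¹' {i} := rfl
    have e2 : (fun ω => (V ω, Y ω)) ⁻¹' t ×ˢ Set.univ = V ⁻¹' t := by ext; simp
    have e3 : (fun ω => (U ω, V ω)) ⁻¹' s ×ˢ t = U ⁻¹' s ∩ V ⁻¹' t := rfl
    rw [e1, e2] at h
    rw [e3, ← h]
    congr 1
    ext ω; simp; tauto
  have hconv : ∀ i, (μ.restrict (X ⁻¹' {i})).map (fun ω => U ω + V ω) =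
      Measure.conv ((μ.restrict (X ⁻¹' {i})).map U) (μ.map V) := by
    intro i
    rw [Measure.conv, hprod, Measure.map_map (by fun_prop) (hUm.prodMk hVm)]
    rfl
  have heq : ∀ i j, (μ.restrict (X ⁻¹' {i})).map (fun ω => U ω + V ω) =
      (μ.restrict (X ⁻¹' {j})).map (fun ω => U ω + V ω) := by
    intro i j
    refine Measure.ext_of_charFun ?_
    ext ζ
    rw [hconv, hconv, charFun_conv, charFun_conv, hc, hc]
  have hpt : ∀ s, MeasurableSet s → ∀ i, μ ((fun ω => U ω + V ω) ⁻¹' s ∩ X ⁻¹' {i}) =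
      μ ((fun ω => U ω + V ω) ⁻¹' s) * (N : ENNReal)⁻¹ := by
    intro s hs i
    have h1 : ∀ j, μ ((fun ω => U ω + V ω) ⁻¹' s ∩ X ⁻¹' {j}) =
        μ ((fun ω => U ω + V ω) ⁻¹' s ∩ X ⁻¹' {i}) := by
      intro j
      have h := congrArg (fun m => m s) (heq j i)
      rwa [Measure.map_apply hsum hs, Measure.map_apply hsum hs,
        Measure.restrict_apply (hsum hs), Measure.restrict_apply (hsum hs)] at h
    rw [measure_eq_sum_fiber μ X hX (hsum hs), Finset.sum_congr rfl fun j _ => h1 j]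
    simp only [Finset.sum_const, Finset.card_univ, Fintype.card_fin, nsmul_eq_mul]
    rw [mul_comm (N : ENNReal), mul_assoc, ENNReal.mul_inv_cancel hN0 hNt, mul_one]
  rw [indepFun_iff_measure_inter_preimage_eq_mul]
  intro s t hs ht
  rw [measure_eq_sum_fiber μ X hX ((hsum hs).inter (hX ht)),
    measure_eq_sum_fiber μ X hX (hX ht), Finset.mul_sum]
  refine Finset.sum_congr rfl fun i _ => ?_
  by_cases hi : i ∈ t
  · have e1 : (X ⁻¹' t) ∩ X ⁻¹' {i} = X ⁻¹' {i} := by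
      ext ω; simp; rintro rfl; exact hi
    rw [Set.inter_assoc, e1, hpt s hs, hXunif]
  · have e1 : (X ⁻¹' t) ∩ X ⁻¹' {i} = ∅ := by
      ext ω; simp; rintro h rfl; exact hi h
    rw [Set.inter_assoc, e1]; simp

/-- Let `Λ₀ ⊆ Λ` be full-rank nested lattices in `ℝ^d`, `Λ₀` of index `N`
in `Λ`, with cosets `Λ_j = u_j + Λ₀` forming the group `G = Λ/Λ₀`, and let `X, Y` be i.i.d.
uniform over `G`.  For each `j`, let `p_j` be a pmf supported within `Λ_j`, with
characteristic function `φ_j`, and `φ_U = φ_V = (1/N) Σ_j φ_j`.  If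
`φ_U φ_V = φ_j φ_V = φ_U φ_j` pointwise for every `j`, then the random variables
`(U, V, X, Y)` with joint pmf `(1/N²) p_i(k) p_j(l)` satisfy (S1) `(U,X) ⫫ (V,Y)`;
(S2) `U+V ⫫ X`, `U+V ⫫ Y`; (S3) the coset of `Λ₀` containing `U+V` equals `X ⊕ Y` a.s. -/
theorem secure_group_computation_of_charfun_conditions
    {d : ℕ} {Ω : Type*} [MeasurableSpace Ω] (μ : Measure Ω) [IsProbabilityMeasure μ]
    -- the nested lattices: coarse Λ₀ with generator matrix A0, fine Λ with generator F
    (A0 F : Matrix (Fin d) (Fin d) ℝ) (hA0 : A0.det ≠ 0) (hF : F.det ≠ 0)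
    (hnested : latticeOfGen A0 ⊆ latticeOfGen F)
    -- the N cosets of Λ₀ in Λ, with representatives u j ∈ Λ
    (N : ℕ) (hN : 0 < N) (u : Fin N → EuclideanSpace ℝ (Fin d))
    (hu : ∀ j, u j ∈ latticeOfGen F)
    (hcover : ∀ x ∈ latticeOfGen F, ∃ j, x - u j ∈ latticeOfGen A0)
    (hdisj : ∀ i j : Fin N, i ≠ j → u i - u j ∉ latticeOfGen A0)
    -- the group operation ⊕ of G = Λ/Λ₀ in terms of the representatives
    (gadd : Fin N → Fin N → Fin N)
    (hgadd : ∀ i j, u i + u j - u (gadd i j) ∈ latticeOfGen A0)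
    -- X, Y i.i.d. uniform over G; U, V the transmitted lattice points
    (X Y : Ω → Fin N) (U V : Ω → EuclideanSpace ℝ (Fin d))
    (hX : Measurable X) (hY : Measurable Y) (hUm : Measurable U) (hVm : Measurable V)
    (hXY : IndepFun X Y μ)
    (hXunif : ∀ j, μ (X ⁻¹' {j}) = (N : ENNReal)⁻¹)
    (hYunif : ∀ j, μ (Y ⁻¹' {j}) = (N : ENNReal)⁻¹)
    -- the pmfs p_j, each supported within the coset Λ_j = u j + Λ₀
    (p : Fin N → EuclideanSpace ℝ (Fin d) → ℝ)
    (hp_nn : ∀ j k, 0 ≤ p j k)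
    (hp_supp : ∀ j k, p j k ≠ 0 → k - u j ∈ latticeOfGen A0)
    (hp_sum : ∀ j, HasSum
      (fun k : ↥{x : EuclideanSpace ℝ (Fin d) | x - u j ∈ latticeOfGen A0} => p j (k : _)) 1)
    -- the characteristic-function conditions φ_U φ_V = φ_j φ_V = φ_U φ_j
    (hchar : ∀ (j : Fin N) (ζ : EuclideanSpace ℝ (Fin d)),
      ((1 / (N : ℂ)) * ∑ i : Fin N, cosetCharFun A0 (u i) (p i) ζ) *
          ((1 / (N : ℂ)) * ∑ i : Fin N, cosetCharFun A0 (u i) (p i) ζ) =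
        cosetCharFun A0 (u j) (p j) ζ *
          ((1 / (N : ℂ)) * ∑ i : Fin N, cosetCharFun A0 (u i) (p i) ζ) ∧
      ((1 / (N : ℂ)) * ∑ i : Fin N, cosetCharFun A0 (u i) (p i) ζ) *
          ((1 / (N : ℂ)) * ∑ i : Fin N, cosetCharFun A0 (u i) (p i) ζ) =
        ((1 / (N : ℂ)) * ∑ i : Fin N, cosetCharFun A0 (u i) (p i) ζ) *
          cosetCharFun A0 (u j) (p j) ζ)
    -- the joint pmf of (U, V, X, Y) is (1/N²) p_i(k) p_j(l)
    (hjoint : ∀ (k l : EuclideanSpace ℝ (Fin d)) (i j : Fin N),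
      μ (U ⁻¹' {k} ∩ V ⁻¹' {l} ∩ X ⁻¹' {i} ∩ Y ⁻¹' {j}) =
        ENNReal.ofReal ((1 / (N : ℝ) ^ 2) * p i k * p j l)) :
    -- (S1)
    IndepFun (fun ω => (U ω, X ω)) (fun ω => (V ω, Y ω)) μ ∧
    -- (S2)
    IndepFun (fun ω => U ω + V ω) X μ ∧ IndepFun (fun ω => U ω + V ω) Y μ ∧
    -- (S3): the coset of Λ₀ containing U + V equals X ⊕ Y almost surely
    (∀ᵐ ω ∂μ, U ω + V ω - u (gadd (X ω) (Y ω)) ∈ latticeOfGen A0) := by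
  classical
  have hP : ∀ i, IsProbabilityMeasure (cosetLaw A0 (u i) (p i)) := fun i =>
    cosetLaw_prob A0 (u i) (p i) (hp_nn i) (hp_sum i)
  have hN0 : (N : ENNReal) ≠ 0 := by exact_mod_cast hN.ne'
  have hNt : (N : ENNReal) ≠ ⊤ := ENNReal.natCast_ne_top N
  -- the common law of `(U, X)` and `(V, Y)`
  set ν : Measure (EuclideanSpace ℝ (Fin d) × Fin N) :=
    ∑ i : Fin N, (N : ENNReal)⁻¹ • (cosetLaw A0 (u i) (p i)).map (fun k => (k, i)) with hν
  have hmk : ∀ i : Fin N, Measurable (fun k : EuclideanSpace ℝ (Fin d) => (k, i)) :=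
    fun i => by fun_prop
  have hνrect : ∀ (s : Set (EuclideanSpace ℝ (Fin d))) (i : Fin N), MeasurableSet s →
      ν (s ×ˢ {i}) = (N : ENNReal)⁻¹ * cosetLaw A0 (u i) (p i) s := by
    intro s i hs
    rw [hν, Measure.finsetSum_apply, Finset.sum_eq_single i]
    · rw [Measure.smul_apply, Measure.map_apply (hmk i) (hs.prod (measurableSet_singleton i))]
      have : (fun k : EuclideanSpace ℝ (Fin d) => (k, i)) ⁻¹' s ×ˢ {i} = s := by
        ext x; simp
      rw [this, smul_eq_mul]
    · intro j _ hj
      rw [Measure.smul_apply, Measure.map_apply (hmk j) (hs.prod (measurableSet_singleton i))]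
      have : (fun k : EuclideanSpace ℝ (Fin d) => (k, j)) ⁻¹' s ×ˢ {i} = ∅ := by
        ext x; simp [hj]
      rw [this]; simp
    · simp
  have hνp : IsProbabilityMeasure ν := by
    constructor
    rw [hν, Measure.finsetSum_apply]
    have : ∀ i : Fin N, ((N : ENNReal)⁻¹ • (cosetLaw A0 (u i) (p i)).map (fun k => (k, i)))
        Set.univ = (N : ENNReal)⁻¹ := by
      intro i
      rw [Measure.smul_apply, Measure.map_apply (hmk i) MeasurableSet.univ]
      simp
    simp only [this, Finset.sum_const, Finset.card_univ, Fintype.card_fin, nsmul_eq_mul]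
    exact ENNReal.mul_inv_cancel hN0 hNt
  -- the support of `ν`
  set C : Set (EuclideanSpace ℝ (Fin d) × Fin N) :=
    {x | x.1 - u x.2 ∈ latticeOfGen A0} with hCdef
  have hCc : C.Countable := by
    have : C ⊆ ⋃ i : Fin N, (fun k => (k, i)) ''
        {x : EuclideanSpace ℝ (Fin d) | x - u i ∈ latticeOfGen A0} := by
      rintro ⟨k, i⟩ h
      exact Set.mem_iUnion.2 ⟨i, k, h, rfl⟩
    exact (Set.countable_iUnion fun i => (coset_countable A0 (u i)).image _).mono this
  have hνC : ν Cᶜ = 0 := by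
    rw [hν, Measure.finsetSum_apply]
    refine Finset.sum_eq_zero fun i _ => ?_
    rw [Measure.smul_apply, Measure.map_apply (hmk i) hCc.measurableSet.compl]
    have : (fun k : EuclideanSpace ℝ (Fin d) => (k, i)) ⁻¹' Cᶜ =
      {x : EuclideanSpace ℝ (Fin d) | x - u i ∈ latticeOfGen A0}ᶜ := rfl
    rw [this, cosetLaw_compl, smul_zero]
  have hνC1 : ν C = 1 := (prob_compl_eq_zero_iff hCc.measurableSet).1 hνC
  have hUX : Measurable (fun ω => (U ω, X ω)) := hUm.prodMk hX
  have hVY : Measurable (fun ω => (V ω, Y ω)) := hVm.prodMk hY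
  have : IsProbabilityMeasure (μ.map (fun ω => ((U ω, X ω), (V ω, Y ω)))) :=
    Measure.isProbabilityMeasure_map (hUX.prodMk hVY).aemeasurable
  have hCC : (ν.prod ν) (C ×ˢ C)ᶜ = 0 := by
    rw [prob_compl_eq_zero_iff (hCc.measurableSet.prod hCc.measurableSet), Measure.prod_prod,
      hνC1, one_mul]
  have hlaw : μ.map (fun ω => ((U ω, X ω), (V ω, Y ω))) = ν.prod ν := by
    refine measure_eq_of_singleton _ _ (C ×ˢ C) (hCc.prod hCc) hCC ?_
    rintro ⟨⟨k, i⟩, ⟨l, j⟩⟩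
    rw [Measure.map_apply (hUX.prodMk hVY) (measurableSet_singleton _)]
    have e1 : (fun ω => ((U ω, X ω), (V ω, Y ω))) ⁻¹' {((k, i), (l, j))} =
        U ⁻¹' {k} ∩ V ⁻¹' {l} ∩ X ⁻¹' {i} ∩ Y ⁻¹' {j} := by
      ext ω; simp; tauto
    rw [e1, hjoint, ← Set.singleton_prod_singleton, Measure.prod_prod,
      ← Set.singleton_prod_singleton, ← Set.singleton_prod_singleton,
      hνrect _ _ (measurableSet_singleton _), hνrect _ _ (measurableSet_singleton _),
      cosetLaw_singleton _ _ _ (hp_supp i), cosetLaw_singleton _ _ _ (hp_supp j)]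
    have hNi : (N : ENNReal)⁻¹ = ENNReal.ofReal ((N : ℝ)⁻¹) := by
      rw [ENNReal.ofReal_inv_of_pos (by exact_mod_cast hN), ENNReal.ofReal_natCast]
    have hNn : (0 : ℝ) ≤ (N : ℝ)⁻¹ := by positivity
    rw [hNi, ← ENNReal.ofReal_mul hNn, ← ENNReal.ofReal_mul hNn,
      ← ENNReal.ofReal_mul (mul_nonneg hNn (hp_nn _ _))]
    congr 1
    rw [one_div, ← inv_pow]
    ring
  have hlawU : μ.map (fun ω => (U ω, X ω)) = ν := by
    have h := congrArg (Measure.map Prod.fst) hlaw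
    rw [Measure.map_map measurable_fst (hUX.prodMk hVY), Measure.map_fst_prod, measure_univ,
      one_smul] at h
    exact h
  have hlawV : μ.map (fun ω => (V ω, Y ω)) = ν := by
    have h := congrArg (Measure.map Prod.snd) hlaw
    rw [Measure.map_map measurable_snd (hUX.prodMk hVY), Measure.map_snd_prod, measure_univ,
      one_smul] at h
    exact h
  have hS1 : IndepFun (fun ω => (U ω, X ω)) (fun ω => (V ω, Y ω)) μ := by
    rw [indepFun_iff_map_prod_eq_prod_map_map hUX.aemeasurable hVY.aemeasurable, hlawU, hlawV,
      hlaw]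
  -- characteristic functions computed from the common law
  have hcf : ∀ (W : Ω → EuclideanSpace ℝ (Fin d)) (Z : Ω → Fin N), Measurable W → Measurable Z →
      μ.map (fun ω => (W ω, Z ω)) = ν → ∀ ζ,
      (∀ i, charFun ((μ.restrict (Z ⁻¹' {i})).map W) ζ =
        (1 / (N : ℂ)) * cosetCharFun A0 (u i) (p i) ζ) ∧
      charFun (μ.map W) ζ = (1 / (N : ℂ)) * ∑ i : Fin N, cosetCharFun A0 (u i) (p i) ζ := by
    intro W Z hW hZ hlawW ζ
    have hr : ∀ i, (μ.restrict (Z ⁻¹' {i})).map W =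
        (N : ENNReal)⁻¹ • cosetLaw A0 (u i) (p i) := by
      intro i
      ext s hs
      rw [Measure.map_apply hW hs, Measure.restrict_apply (hW hs), Measure.smul_apply,
        smul_eq_mul, ← hνrect s i hs, ← hlawW, Measure.map_apply (hW.prodMk hZ)
          (hs.prod (measurableSet_singleton i))]
      rfl
    have hc : ∀ i, charFun ((μ.restrict (Z ⁻¹' {i})).map W) ζ =
        (1 / (N : ℂ)) * cosetCharFun A0 (u i) (p i) ζ := by
      intro i
      rw [hr, charFun_apply, integral_smul_measure, ← charFun_apply,
        charFun_cosetLaw _ _ _ (hp_nn i) (hp_sum i), Complex.real_smul]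
      simp
    refine ⟨hc, ?_⟩
    have hs : μ.map W = ∑ i : Fin N, (μ.restrict (Z ⁻¹' {i})).map W := by
      ext s hs
      rw [Measure.finsetSum_apply, Measure.map_apply hW hs,
        measure_eq_sum_fiber μ Z hZ (hW hs)]
      refine Finset.sum_congr rfl fun i _ => ?_
      rw [Measure.map_apply hW hs, Measure.restrict_apply (hW hs)]
    rw [hs, charFun_apply, integral_finsetSum_measure, Finset.mul_sum]
    · refine Finset.sum_congr rfl fun i _ => ?_
      rw [← charFun_apply, hc]
    · intro i _
      refine Integrable.mono' (g := fun _ => (1 : ℝ)) (integrable_const _) ?_ ?_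
      · exact Continuous.aestronglyMeasurable (by fun_prop)
      · refine Filter.Eventually.of_forall fun x => ?_
        rw [Complex.norm_exp_ofReal_mul_I]
  refine ⟨hS1, ?_, ?_, ?_⟩
  · refine indepFun_add_of_charFun μ hN X Y U V hX hY hUm hVm hXunif hS1
      (fun ζ => (1 / (N : ℂ)) * (((1 / (N : ℂ)) * ∑ i : Fin N, cosetCharFun A0 (u i) (p i) ζ) *
          ((1 / (N : ℂ)) * ∑ i : Fin N, cosetCharFun A0 (u i) (p i) ζ))) ?_
    intro i ζ
    rw [(hcf U X hUm hX hlawU ζ).1 i, (hcf V Y hVm hY hlawV ζ).2, (hchar i ζ).1, mul_assoc]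
  · have h := indepFun_add_of_charFun μ hN Y X V U hY hX hVm hUm hYunif hS1.symm
      (fun ζ => (1 / (N : ℂ)) * (((1 / (N : ℂ)) * ∑ i : Fin N, cosetCharFun A0 (u i) (p i) ζ) *
          ((1 / (N : ℂ)) * ∑ i : Fin N, cosetCharFun A0 (u i) (p i) ζ))) ?_
    · simpa only [add_comm] using h
    intro i ζ
    rw [(hcf V Y hVm hY hlawV ζ).1 i, (hcf U X hUm hX hlawU ζ).2, (hchar i ζ).1, mul_assoc]
  · have h : ∀ᵐ ω ∂μ, ((U ω, X ω), (V ω, Y ω)) ∈ C ×ˢ C := by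
      refine ae_of_ae_map (hUX.prodMk hVY).aemeasurable (p := fun x => x ∈ C ×ˢ C) ?_
      rw [hlaw]
      exact hCC
    filter_upwards [h] with ω hω
    have h1 : U ω - u (X ω) ∈ latticeOfGen A0 := hω.1
    have h2 : V ω - u (Y ω) ∈ latticeOfGen A0 := hω.2
    have h3 := add_mem_latticeOfGen (add_mem_latticeOfGen h1 h2) (hgadd (X ω) (Y ω))
    convert h3 using 1
    abel
end
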